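/- arXiv:2307.12848 — 4 statements merged into one kernel-verified Lean document; each statement's English description precedes it below -/
import Mathlib

section
/- Suppose α = (a_k, b_k, c_k)_{k=1,…,5} ∈ 𝒜̄_X maximizes the volume functional 𝒱 over 𝒜̄_X. Then all fifteen entries a_k, b_k, c_k lie in the open interval (0,1/2); that is, every maximizer of 𝒱 on 𝒜̄_X lies in the interior 𝒜_X and not on the boundary 𝒜̄_X∖𝒜_X. -/
open Real

/-- The Lobachevsky function `Λ(x) = -∫₀ˣ log |2 sin t| dt`. -/
noncomputable def Lob (x : ℝ) : ℝ := -∫ t in (0:ℝ)..x, Real.log |2 * Real.sin t|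

/-- The five balancing equations of the ideal triangulation `X` of `S³∖7₃`. -/
def BalancedX (a b c : Fin 5 → ℝ) : Prop :=
  b 0 + b 1 + a 2 + b 3 + c 3 + a 4 + b 4 = 1 ∧
  b 0 + c 0 + c 1 + b 2 + c 2 + a 3 + c 4 = 1 ∧
  a 1 + b 2 + a 3 + b 3 + a 4 + c 4 = 1 ∧
  a 0 + c 0 + a 1 + c 1 + a 2 = 1 ∧
  a 0 + b 1 + c 2 + c 3 + b 4 = 1

/-- Membership in `𝒜̄_X`, the closure of the space of angle structures. -/
def InAbar (a b c : Fin 5 → ℝ) : Prop :=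
  (∀ k, a k ∈ Set.Icc (0:ℝ) (1/2) ∧ b k ∈ Set.Icc (0:ℝ) (1/2) ∧
    c k ∈ Set.Icc (0:ℝ) (1/2)) ∧
  (∀ k, a k + b k + c k = 1/2) ∧ BalancedX a b c

/-- The volume functional `𝒱`. -/
noncomputable def VolF (a b c : Fin 5 → ℝ) : ℝ :=
  ∑ k, (Lob (2 * π * a k) + Lob (2 * π * b k) + Lob (2 * π * c k))

theorem f_int (a b : ℝ) :
    IntervalIntegrable (fun t => Real.log |2 * Real.sin t|) MeasureTheory.volume a b := by
  simp only [Real.log_abs]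
  have h : MeromorphicOn (fun t : ℝ => 2 * Real.sin t) (Set.uIcc a b) := by
    intro x _
    exact (AnalyticAt.meromorphicAt (by fun_prop))
  exact h.intervalIntegrable_log

theorem Lob_sub (x y : ℝ) :
    Lob y - Lob x = -∫ t in x..y, Real.log |2 * Real.sin t| := by
  unfold Lob
  rw [← intervalIntegral.integral_interval_sub_left (f_int 0 y) (f_int 0 x)]
  ring

theorem Lob_zero : Lob 0 = 0 := by simp [Lob]

theorem Lob_dup (x : ℝ) : Lob (2 * x) = 2 * Lob x + 2 * (Lob (x + π / 2) - Lob (π / 2)) := by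
  rw [Lob_sub]
  have h1 : ∫ t in (0:ℝ)..x, Real.log |2 * Real.sin (t + π / 2)|
      = ∫ t in (π / 2)..(x + π / 2), Real.log |2 * Real.sin t| := by
    have := intervalIntegral.integral_comp_add_right (a := 0) (b := x)
      (fun t => Real.log |2 * Real.sin t|) (π / 2)
    simpa using this
  have h2 : 2 * ∫ t in (0:ℝ)..x, Real.log |2 * Real.sin (2 * t)|
      = ∫ t in (0:ℝ)..(2 * x), Real.log |2 * Real.sin t| := by
    have := intervalIntegral.mul_integral_comp_mul_left (a := 0) (b := x)
      (f := fun t => Real.log |2 * Real.sin t|) 2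
    simpa using this
  have hi : IntervalIntegrable (fun t => Real.log |2 * Real.sin (t + π / 2)|)
      MeasureTheory.volume 0 x := by
    have := (f_int (0 + π / 2) (x + π / 2)).comp_add_right (π / 2)
    simpa using this
  have h3 : ∫ t in (0:ℝ)..x, Real.log |2 * Real.sin (2 * t)|
      = (∫ t in (0:ℝ)..x, Real.log |2 * Real.sin t|)
        + ∫ t in (0:ℝ)..x, Real.log |2 * Real.sin (t + π / 2)| := by
    rw [← intervalIntegral.integral_add (f_int 0 x) hi]
    apply intervalIntegral.integral_congr_ae
    have hc : Set.Countable {t : ℝ | Real.sin (2 * t) = 0} := by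
      have : {t : ℝ | Real.sin (2 * t) = 0} ⊆ Set.range (fun n : ℤ => (n : ℝ) * π / 2) := by
        intro t ht
        obtain ⟨n, hn⟩ := Real.sin_eq_zero_iff.1 ht
        exact ⟨n, by simp only; linarith⟩
      exact (Set.countable_range _).mono this
    filter_upwards [hc.ae_notMem MeasureTheory.volume] with t ht _
    simp only [Real.sin_two_mul] at ht
    have hs : Real.sin t ≠ 0 := by intro h; simp [h] at ht
    have hcs : Real.cos t ≠ 0 := by intro h; simp [h] at ht
    rw [Real.sin_add_pi_div_two, Real.sin_two_mul]
    simp only [Real.log_abs]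
    rw [← Real.log_mul (by positivity) (by positivity)]
    congr 1; ring
  unfold Lob
  rw [← h2, h3, h1]; ring

theorem Lob_pi : Lob π = 0 := by
  have := Lob_dup (π / 2)
  rw [show 2 * (π / 2) = π by ring, show π / 2 + π / 2 = π by ring] at this
  linarith

theorem Lob_pi_sub (x : ℝ) : Lob (π - x) = - Lob x := by
  have h := Lob_sub (π - x) π
  have := intervalIntegral.integral_comp_sub_left (a := 0) (b := x)
      (fun t => Real.log |2 * Real.sin t|) π
  simp only [Real.sin_pi_sub, sub_zero] at this
  rw [← this, Lob_pi] at h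
  unfold Lob at h ⊢
  linarith

theorem Lob_half : Lob (π / 2) = 0 := by
  have := Lob_pi_sub (π / 2)
  rw [show π - π / 2 = π / 2 by ring] at this
  linarith

theorem Lob_sixth : Lob (π / 6) = 3 / 2 * Lob (π / 3) := by
  have h := Lob_dup (π / 6)
  have h2 := Lob_pi_sub (π / 3)
  rw [show 2 * (π / 6) = π / 3 by ring, show π / 6 + π / 2 = π - π / 3 by ring, Lob_half] at h
  linarith

/-- slope bound from below on the integrand -/
theorem Lob_le_of {s x y : ℝ} (hs : 0 < s) (hxy : x ≤ y)
    (h : ∀ t ∈ Set.Icc x y, s ≤ 2 * Real.sin t) :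
    Lob y - Lob x ≤ -(Real.log s * (y - x)) := by
  rw [Lob_sub]
  have : ∫ t in x..y, Real.log s ≤ ∫ t in x..y, Real.log |2 * Real.sin t| := by
    apply intervalIntegral.integral_mono_on hxy (by simp) (f_int x y)
    intro t ht
    have := h t ht
    apply Real.log_le_log hs
    exact this.trans (le_abs_self _)
  rw [intervalIntegral.integral_const, smul_eq_mul] at this
  linarith

/-- slope bound from above on the integrand -/
theorem Lob_ge_of {s x y : ℝ} (hs : 1 ≤ s) (hxy : x ≤ y)
    (h : ∀ t ∈ Set.Icc x y, 0 ≤ Real.sin t ∧ 2 * Real.sin t ≤ s) :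
    -(Real.log s * (y - x)) ≤ Lob y - Lob x := by
  rw [Lob_sub]
  have : ∫ t in x..y, Real.log |2 * Real.sin t| ≤ ∫ t in x..y, Real.log s := by
    apply intervalIntegral.integral_mono_on hxy (f_int x y) (by simp)
    intro t ht
    obtain ⟨h0, h1⟩ := h t ht
    rw [Real.log_abs]
    rcases h0.eq_or_lt with h0 | h0
    · rw [← h0]; simpa using Real.log_nonneg hs
    · exact Real.log_le_log (by positivity) h1
  rw [intervalIntegral.integral_const, smul_eq_mul] at this
  linarith

theorem two_sin_ge {u t : ℝ} (hu0 : 0 ≤ u) (h1 : u ≤ t) (h2 : t ≤ π - u) :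
    Real.sin u ≤ Real.sin t := by
  rcases le_total t (π / 2) with h | h
  · exact Real.sin_le_sin_of_le_of_le_pi_div_two (by linarith [Real.pi_pos]) h h1
  · rw [← Real.sin_pi_sub t]
    exact Real.sin_le_sin_of_le_of_le_pi_div_two (by linarith [Real.pi_pos]) (by linarith)
      (by linarith)

theorem one_le_sqrt3 : (1:ℝ) ≤ √3 := by
  rw [Real.one_le_sqrt]; norm_num

/-- tangent line bound -/
theorem Lob_tangent {x : ℝ} (h0 : 0 ≤ x) (h1 : x ≤ 2 * π / 3) :
    Lob x ≤ Lob (π / 3) - Real.log √3 * (x - π / 3) := by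
  have hp := Real.pi_pos
  have h3 := one_le_sqrt3
  rcases le_total x (π / 3) with h | h
  · have := Lob_ge_of (s := √3) (x := x) (y := π / 3) h3 h ?_
    · linarith
    · rintro t ⟨ht1, ht2⟩
      refine ⟨Real.sin_nonneg_of_nonneg_of_le_pi (by linarith) (by linarith), ?_⟩
      have := two_sin_ge (u := t) (t := π / 3) (by linarith) ht2 (by linarith)
      rw [Real.sin_pi_div_three] at this
      linarith
  · have := Lob_le_of (s := √3) (x := π / 3) (y := x) (by linarith) h ?_
    · linarith
    · rintro t ⟨ht1, ht2⟩
      have := two_sin_ge (u := π / 3) (t := t) (by linarith) ht1 (by linarith)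
      rw [Real.sin_pi_div_three] at this
      linarith

theorem Lob_le_sixth {x : ℝ} (h0 : 0 ≤ x) (h1 : x ≤ π / 2) : Lob x ≤ Lob (π / 6) := by
  have hp := Real.pi_pos
  rcases le_total x (π / 6) with h | h
  · have := Lob_ge_of (s := 1) (x := x) (y := π / 6) le_rfl h ?_
    · simp at this; linarith
    · rintro t ⟨ht1, ht2⟩
      refine ⟨Real.sin_nonneg_of_nonneg_of_le_pi (by linarith) (by linarith), ?_⟩
      have := two_sin_ge (u := t) (t := π / 6) (by linarith) ht2 (by linarith)
      rw [Real.sin_pi_div_six] at this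
      linarith
  · have := Lob_le_of (s := 1) (x := π / 6) (y := x) (by linarith) h ?_
    · simp at this; linarith
    · rintro t ⟨ht1, ht2⟩
      have := two_sin_ge (u := π / 6) (t := t) (by linarith) ht1 (by linarith)
      rw [Real.sin_pi_div_six] at this
      linarith

theorem Lob_nonneg {x : ℝ} (h0 : 0 ≤ x) (h1 : x ≤ π / 2) : 0 ≤ Lob x := by
  have hp := Real.pi_pos
  rcases le_total x (π / 6) with h | h
  · have := Lob_ge_of (s := 1) (x := 0) (y := x) le_rfl h0 ?_
    · rw [Lob_zero] at this; simp at this; linarith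
    · rintro t ⟨ht1, ht2⟩
      refine ⟨Real.sin_nonneg_of_nonneg_of_le_pi (by linarith) (by linarith), ?_⟩
      have := two_sin_ge (u := t) (t := π / 6) (by linarith) (by linarith) (by linarith)
      rw [Real.sin_pi_div_six] at this
      linarith
  · have := Lob_le_of (s := 1) (x := x) (y := π / 2) (by linarith) h1 ?_
    · rw [Lob_half] at this; simp at this; linarith
    · rintro t ⟨ht1, ht2⟩
      have := two_sin_ge (u := π / 6) (t := t) (by linarith) (by linarith) (by linarith)
      rw [Real.sin_pi_div_six] at this
      linarith

theorem Lob_third_pos : 0 < Lob (π / 3) := by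
  have hp := Real.pi_pos
  have h3 := one_le_sqrt3
  have := Lob_le_of (s := √3) (x := π / 3) (y := π / 2) (by linarith) (by linarith) ?_
  · rw [Lob_half] at this
    have hl : 0 < Real.log √3 := Real.log_pos (by
      rw [Real.lt_sqrt] <;> norm_num)
    have : 0 < Real.log √3 * (π / 2 - π / 3) := mul_pos hl (by linarith)
    linarith
  · rintro t ⟨ht1, ht2⟩
    have := two_sin_ge (u := π / 3) (t := t) (by linarith) ht1 (by linarith)
    rw [Real.sin_pi_div_three] at this
    linarith

theorem tet_aux {x y z : ℝ} (hy : 0 ≤ y) (hz : 0 ≤ z) (h : x + y + z = π)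
    (hx : π / 2 ≤ x) : Lob x + Lob y + Lob z ≤ 3 * Lob (π / 3) := by
  have h1 := Lob_le_sixth hy (by linarith)
  have h2 := Lob_le_sixth hz (by linarith)
  have h3 := Lob_nonneg (x := π - x) (by linarith) (by linarith)
  rw [Lob_pi_sub] at h3
  rw [Lob_sixth] at h1 h2
  linarith

theorem tet_le {x y z : ℝ} (hx : 0 ≤ x) (hy : 0 ≤ y) (hz : 0 ≤ z) (h : x + y + z = π) :
    Lob x + Lob y + Lob z ≤ 3 * Lob (π / 3) := by
  rcases le_total (π / 2) x with h1 | h1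
  · exact tet_aux hy hz h h1
  rcases le_total (π / 2) y with h2 | h2
  · linarith [tet_aux (x := y) (y := x) (z := z) hx hz (by linarith) h2]
  rcases le_total (π / 2) z with h3 | h3
  · linarith [tet_aux (x := z) (y := x) (z := y) hx hy (by linarith) h3]
  have e1 := Lob_tangent hx (by linarith)
  have e2 := Lob_tangent hy (by linarith)
  have e3 := Lob_tangent hz (by linarith)
  have : Real.log √3 * (x - π / 3) + Real.log √3 * (y - π / 3) + Real.log √3 * (z - π / 3) = 0 := by
    rw [← mul_add, ← mul_add]
    rw [show x - π / 3 + (y - π / 3) + (z - π / 3) = 0 by linarith, mul_zero]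
  linarith

theorem tet_zero {y z : ℝ} (h : y + z = π) : Lob y + Lob z = 0 := by
  rw [show z = π - y by linarith, Lob_pi_sub]; ring

theorem tet_pos_interior {a b c : ℝ} (ha : 0 ≤ a) (hb : 0 ≤ b) (hc : 0 ≤ c)
    (h : a + b + c = 1 / 2)
    (hV : 0 < Lob (2 * π * a) + Lob (2 * π * b) + Lob (2 * π * c)) :
    a ∈ Set.Ioo (0:ℝ) (1/2) ∧ b ∈ Set.Ioo (0:ℝ) (1/2) ∧ c ∈ Set.Ioo (0:ℝ) (1/2) := by
  have hsum : 2 * π * a + 2 * π * b + 2 * π * c = π := by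
    rw [← mul_add, ← mul_add, h]; ring
  have ha' : 0 < a := by
    rcases ha.eq_or_lt with h0 | h0
    · subst h0
      have := tet_zero (y := 2 * π * b) (z := 2 * π * c) (by linarith)
      rw [mul_zero, Lob_zero] at hV
      linarith
    · exact h0
  have hb' : 0 < b := by
    rcases hb.eq_or_lt with h0 | h0
    · subst h0
      have := tet_zero (y := 2 * π * a) (z := 2 * π * c) (by linarith)
      rw [mul_zero, Lob_zero] at hV
      linarith
    · exact h0
  have hc' : 0 < c := by
    rcases hc.eq_or_lt with h0 | h0
    · subst h0
      have := tet_zero (y := 2 * π * a) (z := 2 * π * b) (by linarith)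
      rw [mul_zero, Lob_zero] at hV
      linarith
    · exact h0
  refine ⟨⟨ha', ?_⟩, ⟨hb', ?_⟩, ⟨hc', ?_⟩⟩ <;> linarith

/-- A test point of volume `13 Λ(π/3)`. -/
theorem test_point : ∃ a b c : Fin 5 → ℝ, InAbar a b c ∧ VolF a b c = 13 * Lob (π / 3) := by
  refine ⟨![1/3, 1/4, 1/6, 1/6, 1/12], ![1/12, 1/12, 1/6, 1/6, 1/4],
    ![1/12, 1/6, 1/6, 1/6, 1/6], ⟨?_, ?_, ?_⟩, ?_⟩
  · intro k; fin_cases k <;> norm_num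
  · intro k; fin_cases k <;> norm_num
  · simp only [BalancedX, Matrix.cons_val]; norm_num
  · have h23 := Lob_pi_sub (π / 3)
    simp only [VolF, Fin.sum_univ_five, Matrix.cons_val]
    rw [show 2 * π * (1 / 3) = π - π / 3 by ring, show 2 * π * (1 / 4) = π / 2 by ring,
      show 2 * π * (1 / 6) = π / 3 by ring, show 2 * π * (1 / 12) = π / 6 by ring,
      h23, Lob_half, Lob_sixth]
    ring

/-- any maximizer of the volume functional on `𝒜̄_X` lies in the
interior `𝒜_X`: all fifteen dihedral-angle parameters lie in `(0, 1/2)`. -/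
theorem maximizer_interior (a b c : Fin 5 → ℝ) (hmem : InAbar a b c)
    (hmax : ∀ a' b' c' : Fin 5 → ℝ, InAbar a' b' c' →
      VolF a' b' c' ≤ VolF a b c) :
    ∀ k, a k ∈ Set.Ioo (0:ℝ) (1/2) ∧ b k ∈ Set.Ioo (0:ℝ) (1/2) ∧
      c k ∈ Set.Ioo (0:ℝ) (1/2) := by
  obtain ⟨a', b', c', hin, hv⟩ := test_point
  have hge := hmax a' b' c' hin
  rw [hv] at hge
  obtain ⟨hb, hs, -⟩ := hmem
  have hp := Real.pi_pos
  have hL := Lob_third_pos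
  have hle : ∀ k, Lob (2 * π * a k) + Lob (2 * π * b k) + Lob (2 * π * c k)
      ≤ 3 * Lob (π / 3) := by
    intro k
    obtain ⟨h1, h2, h3⟩ := hb k
    have ha0 := h1.1
    have hb0 := h2.1
    have hc0 := h3.1
    refine tet_le (by positivity) (by positivity) (by positivity) ?_
    rw [← mul_add, ← mul_add, hs k]; ring
  intro k
  obtain ⟨h1, h2, h3⟩ := hb k
  refine tet_pos_interior h1.1 h2.1 h3.1 (hs k) ?_
  simp only [VolF, Fin.sum_univ_five] at hge
  have := hle 0
  have := hle 1
  have := hle 2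
  have := hle 3
  have := hle 4
  fin_cases k <;> simp only [Fin.zero_eta, Fin.mk_one, Fin.reduceFinMk] <;> linarith
end

section
/- Let d = (d₁,d₂,d₃) ∈ ℝ³ with d₁, d₃ ∈ (-π,0) and d₂ ∈ (0,π), let y⁰ = x⁰ + i·d (x⁰ ∈ ℝ³) satisfy ∇S(y⁰) = 0, let r₀ > 0, and set M := max{Re S(x + i·d) : x ∈ ℝ³, ‖x - x⁰‖ = r₀}. Then there exist constants A, B > 0 such that for all real λ > A, the integral ∫_{x ∈ ℝ³, ‖x - x⁰‖ ≥ r₀} e^{λ S(x + i·d)} dx converges absolutely and |∫_{x ∈ ℝ³, ‖x - x⁰‖ ≥ r₀} e^{λ S(x + i·d)} dx| ≤ B·e^{λM}. -/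
open Real MeasureTheory

/-- The dilogarithm `Li₂(z) = -∫₀¹ Log(1 - z t)/t dt`. -/
noncomputable def Li2 (z : ℂ) : ℂ :=
  -∫ t in (0:ℝ)..1, Complex.log (1 - z * (t : ℂ)) / (t : ℂ)

/-- The potential function `S`. -/
noncomputable def pot (y₁ y₂ y₃ : ℂ) : ℂ :=
  Complex.I * (y₁ ^ 2 - y₁ * y₂ + y₂ * y₃ + y₃ ^ 2 / 2) +
    (-(π : ℂ) * y₁ + (π : ℂ) * y₃) +
    Complex.I * Li2 (-Complex.exp y₁) - Complex.I * Li2 (-Complex.exp y₂) +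
    3 * Complex.I * Li2 (-Complex.exp y₃)

/-- The potential `S` restricted to the slice `ℝ³ + i d`, with `ℝ³` carrying
the Euclidean norm. -/
noncomputable def potSlice (d₁ d₂ d₃ : ℝ) (x : EuclideanSpace ℝ (Fin 3)) : ℂ :=
  pot ((x 0 : ℂ) + (d₁ : ℂ) * Complex.I)
      ((x 1 : ℂ) + (d₂ : ℂ) * Complex.I)
      ((x 2 : ℂ) + (d₃ : ℂ) * Complex.I)

lemma slit_seg {z : ℂ} (hz : 1 - z ∈ Complex.slitPlane) {t : ℝ} (ht : t ∈ Set.Icc (0:ℝ) 1) :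
    1 - z * (t : ℂ) ∈ Complex.slitPlane := by
  have h : (1 : ℂ) + (-z) ∈ Complex.slitPlane := by simpa [sub_eq_add_neg] using hz
  have := StarConvex.add_smul_mem Complex.starConvex_one_slitPlane h ht.1 ht.2
  convert this using 1
  simp [Complex.real_smul]; ring

lemma cont_slit (z : ℂ) : Continuous (fun t : ℝ => 1 - z * (t : ℂ)) := by fun_prop

lemma intg_aux {z : ℂ} (hz : 1 - z ∈ Complex.slitPlane) :
    IntervalIntegrable (fun t : ℝ => Complex.log (1 - z * (t : ℂ)) / (t : ℂ)) volume 0 1 := by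
  set F : ℝ → ℂ := fun t => Complex.log (1 - z * (t : ℂ)) with hF
  set s : Set ℝ := (fun t : ℝ => 1 - z * (t : ℂ)) ⁻¹' Complex.slitPlane with hs
  have hso : IsOpen s := Complex.isOpen_slitPlane.preimage (cont_slit z)
  have h0 : (0 : ℝ) ∈ s := by simp [hs]
  have hdiff : ∀ t ∈ s, DifferentiableAt ℝ F t := by
    intro t ht
    have h1 : HasDerivAt (fun t : ℝ => 1 - z * (t : ℂ)) (-(z * 1)) t :=
      ((Complex.ofRealCLM.hasDerivAt (x := t)).const_mul z).const_sub 1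
    exact (h1.clog_real ht).differentiableAt
  have hc : ContinuousOn (dslope F 0) s :=
    (continuousOn_dslope (hso.mem_nhds h0)).2
      ⟨fun t ht => (hdiff t ht).continuousAt.continuousWithinAt, hdiff 0 h0⟩
  have hc' : ContinuousOn (dslope F 0) (Set.uIcc 0 1) := by
    refine hc.mono ?_
    rw [Set.uIcc_of_le zero_le_one]
    exact fun t ht => slit_seg hz ht
  refine hc'.intervalIntegrable.congr ?_
  intro t ht
  rw [Set.uIoc_of_le zero_le_one] at ht
  have ht0 : t ≠ 0 := ht.1.ne'
  simp only []
  rw [dslope_of_ne _ ht0, slope_def_module]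
  simp [hF, Complex.real_smul]
  field_simp

lemma hasDerivAt_Li2 {z : ℂ} (hz : 1 - z ∈ Complex.slitPlane) :
    HasDerivAt Li2 (∫ t in (0:ℝ)..1, (1 - z * (t : ℂ))⁻¹) z := by
  have hop : IsOpen {w : ℂ | 1 - w ∈ Complex.slitPlane} :=
    Complex.isOpen_slitPlane.preimage (by fun_prop : Continuous fun w : ℂ => 1 - w)
  obtain ⟨ε, hε, hball⟩ := Metric.nhds_basis_closedBall.mem_iff.1 (hop.mem_nhds hz)
  have hK : IsCompact (Metric.closedBall z ε ×ˢ Set.Icc (0:ℝ) 1) :=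
    (isCompact_closedBall z ε).prod isCompact_Icc
  have hcK : ContinuousOn (fun p : ℂ × ℝ => (1 - p.1 * (p.2 : ℂ))⁻¹)
      (Metric.closedBall z ε ×ˢ Set.Icc (0:ℝ) 1) := by
    refine ContinuousOn.inv₀ (by fun_prop) ?_
    rintro ⟨w, t⟩ ⟨hw, ht⟩
    exact Complex.slitPlane_ne_zero (slit_seg (hball hw) ht)
  obtain ⟨C, hC⟩ := hK.exists_bound_of_continuousOn hcK
  have key := intervalIntegral.hasDerivAt_integral_of_dominated_loc_of_deriv_le
    (μ := volume) (a := (0:ℝ)) (b := 1)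
    (F := fun w t => Complex.log (1 - w * (t : ℂ)) / (t : ℂ))
    (F' := fun w t => -(1 - w * (t : ℂ))⁻¹) (x₀ := z) (bound := fun _ => C)
    (Metric.closedBall_mem_nhds z hε) ?_ (intg_aux hz) ?_ ?_ intervalIntegrable_const ?_
  · have h2 := key.2.neg
    rw [intervalIntegral.integral_neg, neg_neg] at h2
    exact h2
  · filter_upwards [Metric.closedBall_mem_nhds z hε] with w hw
    exact (intervalIntegrable_iff.1 (intg_aux (hball hw))).aestronglyMeasurable
  · have : Measurable (fun t : ℝ => -(1 - z * (t : ℂ))⁻¹) := by fun_prop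
    exact this.aestronglyMeasurable
  · refine Filter.Eventually.of_forall fun t ht w hw => ?_
    rw [Set.uIoc_of_le zero_le_one] at ht
    rw [norm_neg]
    exact hC (w, t) ⟨hw, ht.1.le, ht.2⟩
  · refine Filter.Eventually.of_forall fun t ht w hw => ?_
    rw [Set.uIoc_of_le zero_le_one] at ht
    have hm := slit_seg (hball hw) (t := t) ⟨ht.1.le, ht.2⟩
    have ht0 : (t : ℂ) ≠ 0 := by exact_mod_cast ht.1.ne'
    have h1 : HasDerivAt (fun w : ℂ => 1 - w * (t : ℂ)) (-(1 * (t : ℂ))) w :=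
      ((hasDerivAt_id w).mul_const (t : ℂ)).const_sub 1
    have h2 := (h1.clog hm).div_const (t : ℂ)
    refine h2.congr_deriv ?_
    have := Complex.slitPlane_ne_zero hm
    field_simp

/-- `1 + e^y` avoids the cut on the strip. -/
lemma one_add_exp_slit {y : ℂ} (h1 : -π < y.im) (h2 : y.im < π) :
    1 + Complex.exp y ∈ Complex.slitPlane := by
  rw [Complex.mem_slitPlane_iff]
  by_cases h : y.im = 0
  · left
    simp [Complex.exp_re, h]; positivity
  · right
    simp only [Complex.add_im, Complex.one_im, Complex.exp_im, zero_add]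
    refine mul_ne_zero (Real.exp_pos _).ne' ?_
    rw [Ne, Real.sin_eq_zero_iff_of_lt_of_lt h1 h2]
    exact h

lemma hasDerivAt_P {y : ℂ} (h1 : -π < y.im) (h2 : y.im < π) :
    HasDerivAt (fun y => Li2 (-Complex.exp y)) (-Complex.log (1 + Complex.exp y)) y := by
  have hs := one_add_exp_slit h1 h2
  have hz : 1 - (-Complex.exp y) ∈ Complex.slitPlane := by simpa using hs
  have h := (hasDerivAt_Li2 hz).comp y (Complex.hasDerivAt_exp y).neg
  refine h.congr_deriv ?_
  rw [Complex.log_eq_integral hs]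
  have : ∀ t : ℝ, (1 - -Complex.exp y * (t : ℂ))⁻¹ = (1 + t • Complex.exp y)⁻¹ := by
    intro t; simp [Complex.real_smul]; ring
  simp_rw [this]
  ring

/-- slice of the imaginary part of `Li₂(-e^y)`. -/
noncomputable def hh (d t : ℝ) : ℝ := (Li2 (-Complex.exp ((t : ℂ) + (d : ℂ) * Complex.I))).im

lemma hasDerivAt_line {f : ℂ → ℂ} {f' : ℂ} {d t : ℝ}
    (h : HasDerivAt f f' ((t : ℂ) + (d : ℂ) * Complex.I)) :
    HasDerivAt (fun s : ℝ => f ((s : ℂ) + (d : ℂ) * Complex.I)) f' t := by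
  have h' := HasDerivAt.comp_add_const (t : ℂ) ((d : ℂ) * Complex.I) h
  exact h'.comp_ofReal

lemma hasDerivAt_im {f : ℝ → ℂ} {f' : ℂ} {t : ℝ} (h : HasDerivAt f f' t) :
    HasDerivAt (fun s => (f s).im) f'.im t :=
  (Complex.imCLM.hasFDerivAt.comp_hasDerivAt t h)

lemma hasDerivAt_re' {f : ℝ → ℂ} {f' : ℂ} {t : ℝ} (h : HasDerivAt f f' t) :
    HasDerivAt (fun s => (f s).re) f'.re t :=
  (Complex.reCLM.hasFDerivAt.comp_hasDerivAt t h)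

lemma hasDerivAt_hh {d : ℝ} (h1 : -π < d) (h2 : d < π) (t : ℝ) :
    HasDerivAt (hh d) (-Complex.log (1 + Complex.exp ((t : ℂ) + (d : ℂ) * Complex.I))).im t := by
  refine hasDerivAt_im (f := fun t : ℝ => Li2 (-Complex.exp ((t : ℂ) + (d : ℂ) * Complex.I))) ?_
  exact hasDerivAt_line (f := fun y => Li2 (-Complex.exp y))
    (hasDerivAt_P (by simpa using h1) (by simpa using h2))

lemma hasDerivAt_hh2 {d : ℝ} (h1 : -π < d) (h2 : d < π) (t : ℝ) :
    HasDerivAt (fun t : ℝ => (-Complex.log (1 + Complex.exp ((t : ℂ) + (d : ℂ) * Complex.I))).im)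
      (-(Real.exp t * Real.sin d /
        Complex.normSq (1 + Complex.exp ((t : ℂ) + (d : ℂ) * Complex.I)))) t := by
  have hs : 1 + Complex.exp ((t : ℂ) + (d : ℂ) * Complex.I) ∈ Complex.slitPlane :=
    one_add_exp_slit (by simpa using h1) (by simpa using h2)
  have hc := (((Complex.hasDerivAt_exp ((t : ℂ) + (d : ℂ) * Complex.I)).const_add 1).clog hs).neg
  have := hasDerivAt_im (hasDerivAt_line (f := fun y => -Complex.log (1 + Complex.exp y)) hc)
  convert this using 1
  rw [Complex.neg_im, Complex.div_im]
  simp only [Complex.add_re, Complex.add_im, Complex.one_re, Complex.one_im, Complex.exp_re,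
    Complex.exp_im, Complex.ofReal_re, Complex.ofReal_im, Complex.mul_re, Complex.mul_im,
    Complex.I_re, Complex.I_im]
  ring_nf

lemma deriv_hh {d : ℝ} (h1 : -π < d) (h2 : d < π) : deriv (hh d) =
    fun t : ℝ => (-Complex.log (1 + Complex.exp ((t : ℂ) + (d : ℂ) * Complex.I))).im :=
  funext fun t => (hasDerivAt_hh h1 h2 t).deriv

lemma cont_hh {d : ℝ} (h1 : -π < d) (h2 : d < π) : Continuous (hh d) :=
  continuous_iff_continuousAt.2 fun t => (hasDerivAt_hh h1 h2 t).continuousAt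

lemma normSq_pos' {d : ℝ} (h1 : -π < d) (h2 : d < π) (t : ℝ) :
    0 < Complex.normSq (1 + Complex.exp ((t : ℂ) + (d : ℂ) * Complex.I)) :=
  Complex.normSq_pos.2 (Complex.slitPlane_ne_zero
    (one_add_exp_slit (by simpa using h1) (by simpa using h2)))

lemma hh_concave {d : ℝ} (hd : d ∈ Set.Ioo 0 π) : StrictConcaveOn ℝ Set.univ (hh d) := by
  have h1 : -π < d := by linarith [hd.1, Real.pi_pos]
  refine StrictAnti.strictConcaveOn_univ_of_deriv (cont_hh h1 hd.2) ?_
  rw [deriv_hh h1 hd.2]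
  refine strictAnti_of_deriv_neg fun t => ?_
  rw [(hasDerivAt_hh2 h1 hd.2 t).deriv]
  have := Real.sin_pos_of_pos_of_lt_pi hd.1 hd.2
  have := normSq_pos' h1 hd.2 t
  have : 0 < Real.exp t * Real.sin d /
        Complex.normSq (1 + Complex.exp ((t : ℂ) + (d : ℂ) * Complex.I)) := by positivity
  linarith

lemma hh_convex {d : ℝ} (hd : d ∈ Set.Ioo (-π) 0) : StrictConvexOn ℝ Set.univ (hh d) := by
  have h1 : d < π := by linarith [hd.2, Real.pi_pos]
  refine StrictMono.strictConvexOn_univ_of_deriv (cont_hh hd.1 h1) ?_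
  rw [deriv_hh hd.1 h1]
  refine strictMono_of_deriv_pos fun t => ?_
  rw [(hasDerivAt_hh2 hd.1 h1 t).deriv]
  have := Real.sin_neg_of_neg_of_neg_pi_lt hd.2 hd.1
  have := normSq_pos' hd.1 h1 t
  have : 0 < Real.exp t * (-Real.sin d) /
        Complex.normSq (1 + Complex.exp ((t : ℂ) + (d : ℂ) * Complex.I)) := by
    have : 0 < -Real.sin d := by linarith
    positivity
  rw [← neg_div]; linarith [neg_mul_eq_mul_neg (Real.exp t) (Real.sin d), this,
    congrArg (fun u => u / Complex.normSq (1 + Complex.exp ((t : ℂ) + (d : ℂ) * Complex.I))) (neg_mul_eq_mul_neg (Real.exp t) (Real.sin d))]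

lemma max_of_crit {G : ℝ → ℝ} (hG : StrictConcaveOn ℝ Set.univ G) {a : ℝ}
    (ha : HasDerivAt G 0 a) {t : ℝ} (ht : t ≠ a) : G t < G a := by
  rcases lt_or_gt_of_ne ht with h | h
  · have := hG.lt_slope_of_hasDerivAt (Set.mem_univ t) (Set.mem_univ a) h ha
    rw [slope_def_field, lt_div_iff₀ (by linarith)] at this
    linarith
  · have := hG.slope_lt_of_hasDerivAt (Set.mem_univ a) (Set.mem_univ t) h ha
    rw [slope_def_field, div_lt_iff₀ (by linarith)] at this
    linarith

noncomputable def F1 (d₁ d₂ t : ℝ) : ℝ := (-(2 * d₁ - d₂ + π)) * t - hh d₁ t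
noncomputable def F2 (d₁ d₂ d₃ t : ℝ) : ℝ := (d₁ - d₃) * t + hh d₂ t
noncomputable def F3 (d₂ d₃ t : ℝ) : ℝ := (π - d₂ - d₃) * t - 3 * hh d₃ t

lemma re_pot (d₁ d₂ d₃ a b c : ℝ) :
    (pot ((a : ℂ) + (d₁ : ℂ) * Complex.I) ((b : ℂ) + (d₂ : ℂ) * Complex.I)
      ((c : ℂ) + (d₃ : ℂ) * Complex.I)).re = F1 d₁ d₂ a + F2 d₁ d₂ d₃ b + F3 d₂ d₃ c := by
  have h3 : (3 : ℂ) = ((3 : ℝ) : ℂ) := by norm_num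
  have h2 : ∀ z : ℂ, z / 2 = z * ((1 / 2 : ℝ) : ℂ) := by intro z; push_cast; ring
  simp only [pot, F1, F2, F3, hh, h3, h2, pow_two, Complex.add_re, Complex.add_im, Complex.sub_re,
    Complex.sub_im, Complex.neg_re, Complex.neg_im, Complex.ofReal_re, Complex.ofReal_im,
    Complex.mul_re, Complex.mul_im, Complex.I_re, Complex.I_im]
  ring

lemma concave_lin (k : ℝ) : ConcaveOn ℝ Set.univ (fun t : ℝ => k * t) :=
  ⟨convex_univ, fun x _ y _ a b _ _ _ => by simp only [smul_eq_mul]; apply le_of_eq; ring⟩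

lemma F1_concave {d₁ : ℝ} (d₂ : ℝ) (hd₁ : d₁ ∈ Set.Ioo (-π) 0) :
    StrictConcaveOn ℝ Set.univ (F1 d₁ d₂) := by
  have := (concave_lin (-(2 * d₁ - d₂ + π))).add_strictConcaveOn (hh_convex hd₁).neg
  refine this.congr fun t _ => ?_
  simp only [F1, Pi.add_apply, Pi.neg_apply]; ring

lemma F2_concave {d₂ : ℝ} (d₁ d₃ : ℝ) (hd₂ : d₂ ∈ Set.Ioo 0 π) :
    StrictConcaveOn ℝ Set.univ (F2 d₁ d₂ d₃) := by
  have := (concave_lin (d₁ - d₃)).add_strictConcaveOn (hh_concave hd₂)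
  exact this

lemma F3_concave {d₃ : ℝ} (d₂ : ℝ) (hd₃ : d₃ ∈ Set.Ioo (-π) 0) :
    StrictConcaveOn ℝ Set.univ (F3 d₂ d₃) := by
  have h := (hh_convex hd₃).neg
  have := (((concave_lin (π - d₂ - d₃)).add_strictConcaveOn h).add h).add h
  refine this.congr fun t _ => ?_
  simp only [F3, Pi.add_apply, Pi.neg_apply]; ring

lemma diff_P {d : ℝ} (h1 : -π < d) (h2 : d < π) (t : ℝ) :
    DifferentiableAt ℂ (fun y => Li2 (-Complex.exp y)) ((t : ℂ) + (d : ℂ) * Complex.I) :=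
  (hasDerivAt_P (by simpa using h1) (by simpa using h2)).differentiableAt

lemma cont_P {d : ℝ} (h1 : -π < d) (h2 : d < π) :
    Continuous (fun t : ℝ => Li2 (-Complex.exp ((t : ℂ) + (d : ℂ) * Complex.I))) :=
  continuous_iff_continuousAt.2 fun t =>
    (hasDerivAt_line (f := fun y => Li2 (-Complex.exp y))
      (diff_P h1 h2 t).hasDerivAt).continuousAt

lemma cont_potSlice {d₁ d₂ d₃ : ℝ} (hd₁ : d₁ ∈ Set.Ioo (-π) π) (hd₂ : d₂ ∈ Set.Ioo (-π) π)
    (hd₃ : d₃ ∈ Set.Ioo (-π) π) : Continuous (potSlice d₁ d₂ d₃) := by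
  have c1 := (cont_P hd₁.1 hd₁.2).comp
    (by fun_prop : Continuous fun x : EuclideanSpace ℝ (Fin 3) => x 0)
  have c2 := (cont_P hd₂.1 hd₂.2).comp
    (by fun_prop : Continuous fun x : EuclideanSpace ℝ (Fin 3) => x 1)
  have c3 := (cont_P hd₃.1 hd₃.2).comp
    (by fun_prop : Continuous fun x : EuclideanSpace ℝ (Fin 3) => x 2)
  simp only [Function.comp_def] at c1 c2 c3
  unfold potSlice pot
  refine Continuous.add (Continuous.sub (Continuous.add ?_ (c1.const_mul _))
    (c2.const_mul _)) (c3.const_mul _)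
  fun_prop

lemma crit_line {f : ℂ → ℂ} {d a : ℝ} {G : ℝ → ℝ} {k : ℝ}
    (hf : DifferentiableAt ℂ f ((a : ℂ) + (d : ℂ) * Complex.I))
    (h0 : deriv f ((a : ℂ) + (d : ℂ) * Complex.I) = 0)
    (hG : ∀ s : ℝ, (f ((s : ℂ) + (d : ℂ) * Complex.I)).re = G s + k) : HasDerivAt G 0 a := by
  have h := hf.hasDerivAt
  rw [h0] at h
  have h' := hasDerivAt_re' (hasDerivAt_line h)
  simp only [hG, Complex.zero_re] at h'
  have := h'.sub_const k
  simpa using this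

lemma integrable_exp_norm {c : ℝ} (hc : 0 < c) :
    Integrable (fun x : EuclideanSpace ℝ (Fin 3) => Real.exp (-c * ‖x‖)) := by
  refine (integrable_fun_norm_addHaar volume (f := fun r => Real.exp (-c * r))).2 ?_
  have := integrableOn_rpow_mul_exp_neg_mul_rpow (p := 1) (s := 2) (b := c)
    (by norm_num) (by norm_num) hc
  simpa using this

/-- tail estimate for the saddle-point integral. With
`M := max {Re S(x+id) : ‖x - x⁰‖ = r₀}`, there exist `A, B > 0` such that for
all `λ > A` the integral over `{‖x - x⁰‖ ≥ r₀}` of `e^{λ S(x+id)}` converges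
absolutely and is bounded in norm by `B e^{λ M}`. -/
theorem tail_estimate (d₁ d₂ d₃ : ℝ)
    (hd₁ : d₁ ∈ Set.Ioo (-π) 0) (hd₂ : d₂ ∈ Set.Ioo 0 π)
    (hd₃ : d₃ ∈ Set.Ioo (-π) 0) (x₀ : EuclideanSpace ℝ (Fin 3))
    (hcrit :
      deriv (fun w => pot w ((x₀ 1 : ℂ) + (d₂ : ℂ) * Complex.I)
          ((x₀ 2 : ℂ) + (d₃ : ℂ) * Complex.I))
        ((x₀ 0 : ℂ) + (d₁ : ℂ) * Complex.I) = 0 ∧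
      deriv (fun w => pot ((x₀ 0 : ℂ) + (d₁ : ℂ) * Complex.I) w
          ((x₀ 2 : ℂ) + (d₃ : ℂ) * Complex.I))
        ((x₀ 1 : ℂ) + (d₂ : ℂ) * Complex.I) = 0 ∧
      deriv (fun w => pot ((x₀ 0 : ℂ) + (d₁ : ℂ) * Complex.I)
          ((x₀ 1 : ℂ) + (d₂ : ℂ) * Complex.I) w)
        ((x₀ 2 : ℂ) + (d₃ : ℂ) * Complex.I) = 0)
    (r₀ : ℝ) (hr₀ : 0 < r₀) (M : ℝ)
    (hM : IsGreatest
      ((fun x => (potSlice d₁ d₂ d₃ x).re) ''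
        {x : EuclideanSpace ℝ (Fin 3) | ‖x - x₀‖ = r₀}) M) :
    ∃ A B : ℝ, 0 < A ∧ 0 < B ∧ ∀ lam : ℝ, A < lam →
      IntegrableOn
        (fun x => Complex.exp ((lam : ℂ) * potSlice d₁ d₂ d₃ x))
        {x : EuclideanSpace ℝ (Fin 3) | r₀ ≤ ‖x - x₀‖} volume ∧
      ‖∫ x in {x : EuclideanSpace ℝ (Fin 3) | r₀ ≤ ‖x - x₀‖},
          Complex.exp ((lam : ℂ) * potSlice d₁ d₂ d₃ x)‖ ≤
        B * Real.exp (lam * M) := by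
  obtain ⟨hc1, hc2, hc3⟩ := hcrit
  have hpi := Real.pi_pos
  have hb₁ : d₁ ∈ Set.Ioo (-π) π := ⟨hd₁.1, by linarith [hd₁.2]⟩
  have hb₂ : d₂ ∈ Set.Ioo (-π) π := ⟨by linarith [hd₂.1], hd₂.2⟩
  have hb₃ : d₃ ∈ Set.Ioo (-π) π := ⟨hd₃.1, by linarith [hd₃.2]⟩
  have hP1 := diff_P hb₁.1 hb₁.2 (x₀ 0)
  have hP2 := diff_P hb₂.1 hb₂.2 (x₀ 1)
  have hP3 := diff_P hb₃.1 hb₃.2 (x₀ 2)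
  have hD1 : HasDerivAt (F1 d₁ d₂) 0 (x₀ 0) := by
    refine crit_line (k := F2 d₁ d₂ d₃ (x₀ 1) + F3 d₂ d₃ (x₀ 2)) ?_ hc1 fun s => ?_
    · unfold pot; fun_prop
    · rw [re_pot]; ring
  have hD2 : HasDerivAt (F2 d₁ d₂ d₃) 0 (x₀ 1) := by
    refine crit_line (k := F1 d₁ d₂ (x₀ 0) + F3 d₂ d₃ (x₀ 2)) ?_ hc2 fun s => ?_
    · unfold pot; fun_prop
    · rw [re_pot]; ring
  have hD3 : HasDerivAt (F3 d₂ d₃) 0 (x₀ 2) := by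
    refine crit_line (k := F1 d₁ d₂ (x₀ 0) + F2 d₁ d₂ d₃ (x₀ 1)) ?_ hc3 fun s => ?_
    · unfold pot; fun_prop
    · rw [re_pot]; ring
  set f : EuclideanSpace ℝ (Fin 3) → ℝ := fun x => (potSlice d₁ d₂ d₃ x).re with hf
  have hfs : ∀ x, f x = F1 d₁ d₂ (x 0) + F2 d₁ d₂ d₃ (x 1) + F3 d₂ d₃ (x 2) :=
    fun x => re_pot _ _ _ _ _ _
  have hmax1 : ∀ t, t ≠ x₀ 0 → F1 d₁ d₂ t < F1 d₁ d₂ (x₀ 0) :=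
    fun t ht => max_of_crit (F1_concave d₂ hd₁) hD1 ht
  have hmax2 : ∀ t, t ≠ x₀ 1 → F2 d₁ d₂ d₃ t < F2 d₁ d₂ d₃ (x₀ 1) :=
    fun t ht => max_of_crit (F2_concave d₁ d₃ hd₂) hD2 ht
  have hmax3 : ∀ t, t ≠ x₀ 2 → F3 d₂ d₃ t < F3 d₂ d₃ (x₀ 2) :=
    fun t ht => max_of_crit (F3_concave d₂ hd₃) hD3 ht
  have hle1 : ∀ t, F1 d₁ d₂ t ≤ F1 d₁ d₂ (x₀ 0) := fun t => by
    by_cases h : t = x₀ 0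
    · rw [h]
    · exact (hmax1 t h).le
  have hle2 : ∀ t, F2 d₁ d₂ d₃ t ≤ F2 d₁ d₂ d₃ (x₀ 1) := fun t => by
    by_cases h : t = x₀ 1
    · rw [h]
    · exact (hmax2 t h).le
  have hle3 : ∀ t, F3 d₂ d₃ t ≤ F3 d₂ d₃ (x₀ 2) := fun t => by
    by_cases h : t = x₀ 2
    · rw [h]
    · exact (hmax3 t h).le
  have hlt : ∀ x, x ≠ x₀ → f x < f x₀ := by
    intro x hx
    rw [hfs, hfs]
    have e1 := hle1 (x 0)
    have e2 := hle2 (x 1)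
    have e3 := hle3 (x 2)
    by_cases h0 : x 0 = x₀ 0
    · by_cases h1 : x 1 = x₀ 1
      · by_cases h2 : x 2 = x₀ 2
        · exfalso; apply hx
          ext i; fin_cases i
          · exact h0
          · exact h1
          · exact h2
        · linarith [hmax3 _ h2]
      · linarith [hmax2 _ h1]
    · linarith [hmax1 _ h0]
  have hconc : ∀ (x y : EuclideanSpace ℝ (Fin 3)) (s : ℝ), 0 ≤ s → s ≤ 1 →
      (1 - s) * f x + s * f y ≤ f ((1 - s) • x + s • y) := by
    intro x y s hs0 hs1
    have g1 := (F1_concave d₂ hd₁).concaveOn.2 (Set.mem_univ (x 0)) (Set.mem_univ (y 0))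
      (sub_nonneg.2 hs1) hs0 (by ring)
    have g2 := (F2_concave d₁ d₃ hd₂).concaveOn.2 (Set.mem_univ (x 1)) (Set.mem_univ (y 1))
      (sub_nonneg.2 hs1) hs0 (by ring)
    have g3 := (F3_concave d₂ hd₃).concaveOn.2 (Set.mem_univ (x 2)) (Set.mem_univ (y 2))
      (sub_nonneg.2 hs1) hs0 (by ring)
    simp only [smul_eq_mul] at g1 g2 g3
    rw [hfs, hfs, hfs]
    simp only [PiLp.add_apply, PiLp.smul_apply, smul_eq_mul]
    linarith
  obtain ⟨⟨p, hp, hpM⟩, hub⟩ := hM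
  have hpx : p ≠ x₀ := by
    rintro rfl
    simp at hp
    exact hr₀.ne hp
  have hMlt : M < f x₀ := by
    rw [← hpM]; exact hlt p hpx
  set c : ℝ := (f x₀ - M) / r₀ with hcdef
  have hc : 0 < c := div_pos (by linarith) hr₀
  have hcr : c * r₀ = f x₀ - M := by rw [hcdef]; field_simp
  have hray : ∀ x : EuclideanSpace ℝ (Fin 3), r₀ ≤ ‖x - x₀‖ →
      f x ≤ M - c * (‖x - x₀‖ - r₀) := by
    intro x hx
    set ρ := ‖x - x₀‖ with hρ
    have hρ0 : 0 < ρ := lt_of_lt_of_le hr₀ hx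
    have hs0 : 0 ≤ r₀ / ρ := by positivity
    have hs1 : r₀ / ρ ≤ 1 := (div_le_one hρ0).2 hx
    have h1 := hconc x₀ x (r₀ / ρ) hs0 hs1
    have h2 : f ((1 - r₀ / ρ) • x₀ + (r₀ / ρ) • x) ≤ M := by
      refine hub ⟨_, ?_, rfl⟩
      have : (1 - r₀ / ρ) • x₀ + (r₀ / ρ) • x - x₀ = (r₀ / ρ) • (x - x₀) := by
        module
      simp only [Set.mem_ofPred_eq]
      rw [this, norm_smul, Real.norm_of_nonneg hs0, ← hρ]
      field_simp
    have h3 : (1 - r₀ / ρ) * f x₀ + (r₀ / ρ) * f x ≤ M := h1.trans h2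
    have h4 : (ρ - r₀) * f x₀ + r₀ * f x ≤ M * ρ := by
      have := mul_le_mul_of_nonneg_right h3 hρ0.le
      have e : ((1 - r₀ / ρ) * f x₀ + (r₀ / ρ) * f x) * ρ = (ρ - r₀) * f x₀ + r₀ * f x := by
        field_simp
      linarith
    have h5 : r₀ * f x ≤ r₀ * (M - c * (ρ - r₀)) := by
      have : r₀ * (M - c * (ρ - r₀)) = r₀ * M - (c * r₀) * (ρ - r₀) := by ring
      rw [this, hcr]
      linarith
    exact le_of_mul_le_mul_left h5 hr₀
  set g : EuclideanSpace ℝ (Fin 3) → ℝ := fun x => Real.exp (-c * ‖x - x₀‖ + c * r₀) with hg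
  have hgi : Integrable g := by
    have := ((integrable_exp_norm hc).comp_sub_right x₀).mul_const (Real.exp (c * r₀))
    refine this.congr (Filter.Eventually.of_forall fun x => ?_)
    simp only [hg, Real.exp_add]
  have hg0 : 0 ≤ ∫ x, g x := integral_nonneg fun x => (Real.exp_pos _).le
  refine ⟨1, (∫ x, g x) + 1, one_pos, by linarith, fun lam hlam => ?_⟩
  set T : Set (EuclideanSpace ℝ (Fin 3)) := {x | r₀ ≤ ‖x - x₀‖} with hT
  have hTm : MeasurableSet T :=
    (isClosed_le continuous_const (by fun_prop)).measurableSet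
  have hcont : Continuous (fun x => Complex.exp ((lam : ℂ) * potSlice d₁ d₂ d₃ x)) :=
    Complex.continuous_exp.comp ((cont_potSlice hb₁ hb₂ hb₃).const_mul _)
  have hbound : ∀ x ∈ T, ‖Complex.exp ((lam : ℂ) * potSlice d₁ d₂ d₃ x)‖ ≤
      Real.exp (lam * M) * g x := by
    intro x hx
    rw [Complex.norm_exp, Complex.re_ofReal_mul, hg, ← Real.exp_add, Real.exp_le_exp]
    have h1 : f x ≤ M - c * (‖x - x₀‖ - r₀) := hray x hx
    have h2 : 0 ≤ c * (‖x - x₀‖ - r₀) := mul_nonneg hc.le (sub_nonneg.2 hx)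
    change lam * f x ≤ _
    have h3 := mul_le_mul_of_nonneg_left h1 (by linarith : 0 ≤ lam)
    nlinarith
  have hgi' : IntegrableOn (fun x => Real.exp (lam * M) * g x) T :=
    (hgi.const_mul _).integrableOn
  have hae : ∀ᵐ x ∂(volume.restrict T), ‖Complex.exp ((lam : ℂ) * potSlice d₁ d₂ d₃ x)‖ ≤
      Real.exp (lam * M) * g x := (ae_restrict_iff' hTm).2 (Filter.Eventually.of_forall hbound)
  refine ⟨Integrable.mono' hgi' hcont.aestronglyMeasurable hae, ?_⟩
  calc ‖∫ x in T, Complex.exp ((lam : ℂ) * potSlice d₁ d₂ d₃ x)‖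
      ≤ ∫ x in T, Real.exp (lam * M) * g x := norm_integral_le_of_norm_le hgi' hae
    _ ≤ ∫ x, Real.exp (lam * M) * g x :=
        setIntegral_le_integral (hgi.const_mul _)
          (Filter.Eventually.of_forall fun x => by positivity)
    _ = Real.exp (lam * M) * ∫ x, g x := integral_const_mul _ _
    _ ≤ ((∫ x, g x) + 1) * Real.exp (lam * M) := by
        nlinarith [Real.exp_pos (lam * M)]
end

section
/- Let d = (d₁,d₂,d₃) ∈ ℝ³ with d₁, d₃ ∈ (-π,0) and d₂ ∈ (0,π), and let y⁰ = x⁰ + i·d (x⁰ ∈ ℝ³) satisfy ∇S(y⁰) = 0. Then there exists ρ ∈ ℂ, ρ ≠ 0, such that as real λ → ∞, ∫_{ℝ³} e^{λ S(x + i·d)} dx = ρ·λ^{-3/2}·e^{λ S(y⁰)}·(1 + o(1)). In particular, (1/λ)·log|∫_{ℝ³} e^{λ S(x + i·d)} dx| → Re S(y⁰) as λ → ∞. -/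
open Real MeasureTheory Filter

lemma one_sub_mul_mem_slit {z : ℂ} (hz : z.im ≠ 0) (t : ℝ) : 1 - z * (t : ℂ) ∈ Complex.slitPlane := by
  rcases eq_or_ne t 0 with rfl | ht
  · simp
  · right
    simp [hz, ht]

lemma hasDerivAt_Li2_s15 {z : ℂ} (hz : z.im ≠ 0) :
    HasDerivAt Li2 (-(Complex.log (1 - z) / z)) z := by
  have hopen : IsOpen {w : ℂ | w.im ≠ 0} := isOpen_ne_fun Complex.continuous_im continuous_const
  obtain ⟨r, hr, hball⟩ := Metric.nhds_basis_closedBall.mem_iff.1 (hopen.mem_nhds hz)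
  have hK : IsCompact (Metric.closedBall z r ×ˢ Set.Icc (0:ℝ) 1) :=
    (isCompact_closedBall z r).prod isCompact_Icc
  have hcont : ContinuousOn (fun p : ℂ × ℝ => -(1 - p.1 * (p.2 : ℂ))⁻¹)
      (Metric.closedBall z r ×ˢ Set.Icc (0:ℝ) 1) := by
    apply ContinuousOn.neg
    apply ContinuousOn.inv₀ (by fun_prop)
    rintro ⟨w, t⟩ ⟨hw, -⟩
    exact Complex.slitPlane_ne_zero (one_sub_mul_mem_slit (hball hw) t)
  obtain ⟨C, hC⟩ := hK.exists_bound_of_continuousOn hcont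
  have hder : ∀ w : ℂ, w.im ≠ 0 → ∀ t : ℝ,
      HasDerivAt (fun s : ℝ => Complex.log (1 - w * (s : ℂ))) (-w / (1 - w * (t : ℂ))) t := by
    intro w hw t
    have h1 : HasDerivAt (fun s : ℝ => 1 - w * (s : ℂ)) (-w) t := by
      simpa using ((Complex.ofRealCLM.hasDerivAt (x := t)).const_mul w).const_sub 1
    exact h1.clog_real (one_sub_mul_mem_slit hw t)
  have key := intervalIntegral.hasDerivAt_integral_of_dominated_loc_of_deriv_le
    (μ := volume) (a := 0) (b := 1) (x₀ := z) (s := Metric.closedBall z r)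
    (F := fun w t => Complex.log (1 - w * (t : ℂ)) / (t : ℂ))
    (F' := fun w t => -(1 - w * (t : ℂ))⁻¹) (bound := fun _ => C)
    (Metric.closedBall_mem_nhds z hr) ?_ ?_ ?_ ?_ ?_ ?_
  · have h2 : (∫ t in (0:ℝ)..1, -(1 - z * (t : ℂ))⁻¹) = Complex.log (1 - z) / z := by
      have hz0 : z ≠ 0 := by rintro rfl; simp at hz
      have : ∀ t : ℝ, HasDerivAt (fun s : ℝ => Complex.log (1 - z * (s : ℂ)) / z)
          (-(1 - z * (t : ℂ))⁻¹) t := by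
        intro t
        refine ((hder z hz t).div_const z).congr_deriv ?_
        have := Complex.slitPlane_ne_zero (one_sub_mul_mem_slit hz t)
        field_simp
      rw [intervalIntegral.integral_eq_sub_of_hasDerivAt (fun t _ => this t) key.1]
      simp
    rw [← h2]
    exact key.2.neg
  · exact Eventually.of_forall fun w => by
      apply Measurable.aestronglyMeasurable
      fun_prop
  · have hc : ContinuousOn (dslope (fun s : ℝ => Complex.log (1 - z * (s : ℂ))) 0) (Set.uIcc 0 1) := by
      intro t _
      apply ContinuousAt.continuousWithinAt
      rcases eq_or_ne t 0 with rfl | ht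
      · exact continuousAt_dslope_same.2 (hder z hz 0).differentiableAt
      · exact (continuousAt_dslope_of_ne ht).2 (hder z hz t).continuousAt
    refine hc.intervalIntegrable.congr ?_
    intro t ht
    have ht0 : t ≠ 0 := by
      rw [Set.uIoc_of_le zero_le_one] at ht
      exact ht.1.ne'
    simp only [dslope_of_ne _ ht0, slope, vsub_eq_sub, sub_zero]
    simp [div_eq_inv_mul]
  · apply Measurable.aestronglyMeasurable
    fun_prop
  · refine Eventually.of_forall fun t ht w hw => hC (w, t) ⟨hw, ?_⟩
    rw [Set.uIoc_of_le zero_le_one] at ht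
    exact ⟨ht.1.le, ht.2⟩
  · simp
  · refine Eventually.of_forall fun t ht w hw => ?_
    rw [Set.uIoc_of_le zero_le_one] at ht
    have h1 : HasDerivAt (fun w : ℂ => 1 - w * (t : ℂ)) (-(t:ℂ)) w := by
      simpa using ((hasDerivAt_id w).mul_const (t : ℂ)).const_sub 1
    refine ((h1.clog (one_sub_mul_mem_slit (hball hw) t)).div_const (t : ℂ)).congr_deriv ?_
    have := Complex.slitPlane_ne_zero (one_sub_mul_mem_slit (hball hw) t)
    have ht0 : (t : ℂ) ≠ 0 := by exact_mod_cast ht.1.ne'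
    field_simp

lemma exp_im_ne {y : ℂ} (hy : Real.sin y.im ≠ 0) : (-Complex.exp y).im ≠ 0 := by
  simp [Complex.exp_im, hy, (Real.exp_pos _).ne']

/-- the function `y ↦ Li₂(-e^y)` has derivative `-Log(1+e^y)`. -/
lemma hasDerivAt_Li2_exp {y : ℂ} (hy : Real.sin y.im ≠ 0) :
    HasDerivAt (fun w => Li2 (-Complex.exp w)) (-Complex.log (1 + Complex.exp y)) y := by
  have h := (hasDerivAt_Li2_s15 (exp_im_ne hy)).comp y (Complex.hasDerivAt_exp y).neg
  refine h.congr_deriv ?_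
  have := Complex.exp_ne_zero y
  simp only [sub_neg_eq_add]
  field_simp

lemma one_add_exp_mem {y : ℂ} (hy : Real.sin y.im ≠ 0) :
    1 + Complex.exp y ∈ Complex.slitPlane := by
  right
  simp [Complex.exp_im, hy, (Real.exp_pos _).ne']

lemma hasDerivAt_log_one_add_exp {y : ℂ} (hy : Real.sin y.im ≠ 0) :
    HasDerivAt (fun w => Complex.log (1 + Complex.exp w))
      (Complex.exp y / (1 + Complex.exp y)) y :=
  ((Complex.hasDerivAt_exp y).const_add 1).clog (one_add_exp_mem hy)

lemma im_sigma {y : ℂ} :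
    (Complex.exp y / (1 + Complex.exp y)).im =
      Real.sin y.im * (Real.exp y.re / Complex.normSq (1 + Complex.exp y)) := by
  rw [Complex.div_im]
  simp [Complex.exp_im, Complex.exp_re]
  ring

/-- one-variable phase datum: `A` vanishes to second order at `0` and its real part is strictly
concave. -/
structure Phase (A : ℝ → ℂ) (c : ℂ) : Prop where
  zero : A 0 = 0
  ex : ∃ B C : ℝ → ℂ, (∀ v, HasDerivAt A (B v) v) ∧ B 0 = 0 ∧ (∀ v, HasDerivAt B (C v) v) ∧
    (∀ v, (C v).re < 0) ∧ C 0 = c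

lemma Phase.neg {A : ℝ → ℂ} {c : ℂ} (h : Phase A c) : c.re < 0 := by
  obtain ⟨B, C, -, -, -, h4, h5⟩ := h.ex
  exact h5 ▸ h4 0

lemma Phase.continuous {A : ℝ → ℂ} {c : ℂ} (h : Phase A c) : Continuous A := by
  obtain ⟨B, C, h1, -⟩ := h.ex
  exact continuous_iff_continuousAt.2 fun v => (h1 v).continuousAt

lemma Phase.tendsto {A : ℝ → ℂ} {c : ℂ} (h : Phase A c) (u : ℝ) :
    Tendsto (fun s : ℝ => (s : ℂ) ^ 2 * A (s⁻¹ * u)) atTop (nhds (c / 2 * (u : ℂ) ^ 2)) := by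
  obtain ⟨B, C, h1, h2, h3, h4, h5⟩ := h.ex
  have hB : (fun v : ℝ => B v - c * (v : ℂ)) =o[nhdsWithin 0 Set.univ]
      fun v : ℝ => (v - 0) ^ 1 := by
    have := (h3 0).isLittleO
    rw [h5, h2] at this
    rw [nhdsWithin_univ]
    simpa [mul_comm] using this
  have hA := Convex.isLittleO_pow_succ_real (f := fun v : ℝ => A v - c / 2 * (v : ℂ) ^ 2)
    convex_univ (Set.mem_univ 0) (fun v _ => by
      refine HasDerivAt.hasDerivWithinAt ?_
      have := (((Complex.ofRealCLM.hasDerivAt (x := v)).pow 2).const_mul (c / 2))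
      refine ((h1 v).sub this).congr_deriv ?_
      simp
      ring) hB
  simp only [nhdsWithin_univ, h.zero, sub_zero, Complex.ofReal_zero] at hA
  have hs : Tendsto (fun s : ℝ => s⁻¹ * u) atTop (nhds 0) := by
    simpa using tendsto_inv_atTop_zero.mul_const u
  have hA2 := hA.comp_tendsto hs
  have hA3 : (fun s : ℝ => A (s⁻¹ * u) - c / 2 * ((s⁻¹ * u : ℝ) : ℂ) ^ 2) =o[atTop]
      fun s : ℝ => s⁻¹ ^ 2 := by
    refine Asymptotics.IsLittleO.trans_isBigO (by simpa [Function.comp_def] using hA2) ?_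
    refine Asymptotics.IsBigO.of_bound (u ^ 2) (Eventually.of_forall fun s => ?_)
    simp [mul_pow, mul_comm]
  have hA4 : Tendsto (fun s : ℝ => (s : ℂ) ^ 2 *
      (A (s⁻¹ * u) - c / 2 * ((s⁻¹ * u : ℝ) : ℂ) ^ 2)) atTop (nhds 0) := by
    have hO : (fun s : ℝ => (s : ℂ) ^ 2) =O[atTop] fun s : ℝ => s ^ 2 :=
      Asymptotics.IsBigO.of_bound 1 (Eventually.of_forall fun s => by simp)
    have := hO.mul_isLittleO hA3
    rw [← Asymptotics.isLittleO_one_iff ℝ]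
    refine this.trans_isBigO ?_
    refine Asymptotics.IsBigO.of_bound 1 ?_
    filter_upwards [eventually_gt_atTop 0] with s hs
    simp [hs.ne']
  have := hA4.add_const (c / 2 * (u : ℂ) ^ 2)
  rw [zero_add] at this
  refine this.congr' ?_
  filter_upwards [eventually_gt_atTop 0] with s hs
  have : (s : ℂ) ≠ 0 := by exact_mod_cast hs.ne'
  push_cast
  field_simp
  ring

/-- tangent line bound -/
lemma tangent_bound {f g : ℝ → ℝ} (hf : ∀ v, HasDerivAt f (g v) v) (hg : Antitone g) (a v : ℝ) :
    f v ≤ f a + g a * (v - a) := by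
  have hconc : ConcaveOn ℝ Set.univ f := by
    have hd : deriv f = g := funext fun v => (hf v).deriv
    refine AntitoneOn.concaveOn_of_deriv convex_univ ?_ ?_ ?_
    · exact fun v _ => (hf v).continuousAt.continuousWithinAt
    · exact fun v _ => (hf v).differentiableAt.differentiableWithinAt
    · rw [hd]; exact hg.antitoneOn _
  rcases lt_trichotomy v a with h | rfl | h
  · have := hconc.le_slope_of_hasDerivAt (Set.mem_univ v) (Set.mem_univ a) h (hf a)
    rw [slope_def_field, le_div_iff₀ (by linarith)] at this
    linarith
  · simp
  · have := hconc.slope_le_of_hasDerivAt (Set.mem_univ a) (Set.mem_univ v) h (hf a)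
    rw [slope_def_field, div_le_iff₀ (by linarith)] at this
    linarith

lemma Phase.bound {A : ℝ → ℂ} {c : ℂ} (h : Phase A c) :
    ∃ k : ℝ, 0 < k ∧ ∀ᶠ s : ℝ in atTop, ∀ u : ℝ,
      s ^ 2 * (A (s⁻¹ * u)).re ≤ -k * (|u| - 1) := by
  have hneg := h.neg
  obtain ⟨B, C, h1, h2, h3, h4, h5⟩ := h.ex
  have hf : ∀ v, HasDerivAt (fun v => (A v).re) ((B v).re) v := fun v =>
    Complex.reCLM.hasFDerivAt.comp_hasDerivAt v (h1 v)
  have hg : ∀ v, HasDerivAt (fun v => (B v).re) ((C v).re) v := fun v =>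
    Complex.reCLM.hasFDerivAt.comp_hasDerivAt v (h3 v)
  have hanti : Antitone (fun v => (B v).re) :=
    antitone_of_hasDerivAt_nonpos hg fun v => (h4 v).le
  have htb := tangent_bound hf hanti
  have hnonpos : ∀ v, (A v).re ≤ 0 := fun v => by
    have := htb 0 v
    simpa [h.zero, h2] using this
  have hslope : Tendsto (fun t : ℝ => t⁻¹ * (B t).re) (nhdsWithin 0 {0}ᶜ) (nhds c.re) := by
    have := hasDerivAt_iff_tendsto_slope_zero.1 (hg 0)
    simpa [h2, h5] using this
  have hp : Tendsto (fun s : ℝ => s * (B s⁻¹).re) atTop (nhds c.re) := by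
    have hs : Tendsto (fun s : ℝ => s⁻¹) atTop (nhdsWithin 0 {0}ᶜ) :=
      tendsto_nhdsWithin_iff.2 ⟨tendsto_inv_atTop_zero, by
        filter_upwards [eventually_gt_atTop 0] with s hs
        simp [hs.ne']⟩
    simpa [Function.comp_def] using hslope.comp hs
  have hm : Tendsto (fun s : ℝ => s * (B (-s⁻¹)).re) atTop (nhds (-c.re)) := by
    have hs : Tendsto (fun s : ℝ => -s⁻¹) atTop (nhdsWithin 0 {0}ᶜ) :=
      tendsto_nhdsWithin_iff.2 ⟨by simpa using tendsto_inv_atTop_zero.neg (G := ℝ), by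
        filter_upwards [eventually_gt_atTop 0] with s hs
        simp [hs.ne']⟩
    have := (hslope.comp hs).neg
    simpa [Function.comp_def, inv_neg] using this
  refine ⟨-c.re / 2, by linarith, ?_⟩
  filter_upwards [eventually_gt_atTop 0, hp.eventually_lt_const (show c.re < c.re / 2 by linarith),
    hm.eventually_const_lt (show -c.re / 2 < -c.re by linarith)] with s hs hp hm u
  have e1 := mul_le_mul_of_nonneg_left (htb s⁻¹ (s⁻¹ * u)) (sq_nonneg s)
  have e2 := mul_le_mul_of_nonneg_left (htb (-s⁻¹) (s⁻¹ * u)) (sq_nonneg s)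
  have n1 := mul_nonpos_of_nonneg_of_nonpos (sq_nonneg s) (hnonpos s⁻¹)
  have n2 := mul_nonpos_of_nonneg_of_nonpos (sq_nonneg s) (hnonpos (-s⁻¹))
  have n3 := mul_nonpos_of_nonneg_of_nonpos (sq_nonneg s) (hnonpos (s⁻¹ * u))
  have r1 : s ^ 2 * ((A s⁻¹).re + (B s⁻¹).re * (s⁻¹ * u - s⁻¹)) =
      s ^ 2 * (A s⁻¹).re + (s * (B s⁻¹).re) * (u - 1) := by
    field_simp
  have r2 : s ^ 2 * ((A (-s⁻¹)).re + (B (-s⁻¹)).re * (s⁻¹ * u - -s⁻¹)) =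
      s ^ 2 * (A (-s⁻¹)).re + (s * (B (-s⁻¹)).re) * (u + 1) := by
    field_simp
    ring
  rw [r1] at e1
  rw [r2] at e2
  rcases le_total |u| 1 with hu | hu
  · nlinarith
  · rcases le_total 0 u with h0 | h0
    · rw [abs_of_nonneg h0] at hu ⊢
      nlinarith
    · rw [abs_of_nonpos h0] at hu ⊢
      nlinarith

lemma Phase_of (κ : ℝ) (x d : ℝ) (hκ : κ * Real.sin d < 0) :
    Phase (fun v : ℝ => (κ : ℂ) * Complex.I *
      (Li2 (-Complex.exp ((x + d * Complex.I) + v)) - Li2 (-Complex.exp (x + d * Complex.I)) +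
        v * Complex.log (1 + Complex.exp (x + d * Complex.I))))
      (-((κ : ℂ) * Complex.I * (Complex.exp (x + d * Complex.I) /
        (1 + Complex.exp (x + d * Complex.I))))) := by
  have hsin : Real.sin d ≠ 0 := by rintro h; simp [h] at hκ
  set y : ℂ := x + d * Complex.I with hy
  have him : ∀ v : ℝ, (y + v).im = d := fun v => by simp [hy]
  have him' : ∀ v : ℝ, Real.sin (y + v).im ≠ 0 := fun v => by rwa [him]
  have hadd : ∀ v : ℝ, HasDerivAt (fun v : ℝ => y + (v : ℂ)) 1 v := fun v => by
    simpa using (Complex.ofRealCLM.hasDerivAt (x := v)).const_add y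
  refine ⟨by simp, fun v => (κ : ℂ) * Complex.I * (-Complex.log (1 + Complex.exp (y + v)) +
    Complex.log (1 + Complex.exp y)), fun v => -((κ : ℂ) * Complex.I * (Complex.exp (y + v) /
        (1 + Complex.exp (y + v)))), ?_, by simp, ?_, ?_, by simp⟩
  · intro v
    have h1 := (hasDerivAt_Li2_exp (him' v)).comp v (hadd v)
    have h2 := (Complex.ofRealCLM.hasDerivAt (x := v)).mul_const (Complex.log (1 + Complex.exp y))
    refine (((h1.sub_const (Li2 (-Complex.exp y))).add h2).const_mul
      ((κ : ℂ) * Complex.I)).congr_deriv ?_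
    simp
  · intro v
    have h1 := (hasDerivAt_log_one_add_exp (him' v)).comp v (hadd v)
    refine ((h1.neg.add_const (Complex.log (1 + Complex.exp y))).const_mul
      ((κ : ℂ) * Complex.I)).congr_deriv ?_
    simp
  · intro v
    have e : (-((κ : ℂ) * Complex.I * (Complex.exp (y + v) / (1 + Complex.exp (y + v))))).re =
        κ * (Complex.exp (y + v) / (1 + Complex.exp (y + v))).im := by
      rw [mul_assoc, Complex.neg_re, Complex.re_ofReal_mul, Complex.I_mul_re]
      ring
    rw [e, im_sigma, him, ← mul_assoc]
    refine mul_neg_of_neg_of_pos hκ ?_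
    have := Complex.normSq_pos.2 (Complex.slitPlane_ne_zero (one_add_exp_mem (him' v)))
    positivity

lemma gauss_ne_zero {c₁ c₂ c₃ : ℂ} (h₁ : c₁.re < 0) (h₂ : c₂.re < 0) (h₃ : c₃.re < 0) :
    (∫ u : EuclideanSpace ℝ (Fin 3), Complex.exp
      (Complex.I * ((u 0 : ℂ) ^ 2 - u 0 * u 1 + u 1 * u 2 + (u 2 : ℂ) ^ 2 / 2) +
        (c₁ / 2 * (u 0 : ℂ) ^ 2 + c₂ / 2 * (u 1 : ℂ) ^ 2 + c₃ / 2 * (u 2 : ℂ) ^ 2))) ≠ 0 := by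
  set G : (Fin 3 → ℝ) → ℂ := fun u => Complex.exp
      (Complex.I * ((u 0 : ℂ) ^ 2 - u 0 * u 1 + u 1 * u 2 + (u 2 : ℂ) ^ 2 / 2) +
        (c₁ / 2 * (u 0 : ℂ) ^ 2 + c₂ / 2 * (u 1 : ℂ) ^ 2 + c₃ / 2 * (u 2 : ℂ) ^ 2)) with hG
  have e1 : (∫ u : EuclideanSpace ℝ (Fin 3), Complex.exp
      (Complex.I * ((u 0 : ℂ) ^ 2 - u 0 * u 1 + u 1 * u 2 + (u 2 : ℂ) ^ 2 / 2) +
        (c₁ / 2 * (u 0 : ℂ) ^ 2 + c₂ / 2 * (u 1 : ℂ) ^ 2 + c₃ / 2 * (u 2 : ℂ) ^ 2)))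
      = ∫ u, G u :=
    (EuclideanSpace.volume_preserving_symm_measurableEquiv_toLp (Fin 3)).integral_comp' G
  set b₁ : ℂ := Complex.I + c₁ / 2 with hb₁
  set b₃ : ℂ := Complex.I / 2 + c₃ / 2 with hb₃
  have r₁ : b₁.re < 0 := by simp [hb₁]; linarith
  have r₃ : b₃.re < 0 := by simp [hb₃]; linarith
  have hGint : Integrable G := by
    have hprod : Integrable (fun u : Fin 3 → ℝ => ∏ i, (![fun t : ℝ => Complex.exp (c₁ / 2 * (t : ℂ) ^ 2 + 0 * t + 0),
        fun t : ℝ => Complex.exp (c₂ / 2 * (t : ℂ) ^ 2 + 0 * t + 0),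
        fun t : ℝ => Complex.exp (c₃ / 2 * (t : ℂ) ^ 2 + 0 * t + 0)] : Fin 3 → ℝ → ℂ) i (u i)) := by
      apply Integrable.fintype_prod
      intro i
      fin_cases i
      · exact integrable_cexp_quadratic' (by simp; linarith) 0 0
      · exact integrable_cexp_quadratic' (by simp; linarith) 0 0
      · exact integrable_cexp_quadratic' (by simp; linarith) 0 0
    refine hprod.mono (by apply Continuous.aestronglyMeasurable; fun_prop)
      (Eventually.of_forall fun u => le_of_eq ?_)
    simp only [hG, Fin.prod_univ_three, Matrix.cons_val_zero, Matrix.cons_val_one, Matrix.cons_val]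
    rw [← Complex.exp_add, ← Complex.exp_add, Complex.norm_exp, Complex.norm_exp]
    congr 1
    rw [Complex.add_re]
    have : (Complex.I * ((u 0 : ℂ) ^ 2 - u 0 * u 1 + u 1 * u 2 + (u 2 : ℂ) ^ 2 / 2)).re = 0 := by
      rw [show ((u 0 : ℂ) ^ 2 - u 0 * u 1 + u 1 * u 2 + (u 2 : ℂ) ^ 2 / 2) =
        ((u 0 ^ 2 - u 0 * u 1 + u 1 * u 2 + u 2 ^ 2 / 2 : ℝ) : ℂ) by push_cast; ring]
      simp only [Complex.I_mul_re, Complex.ofReal_im, neg_zero]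
    rw [this, zero_add]
    simp only [zero_mul, add_zero]
  have mp := (volume_preserving_piFinSuccAbove (fun _ : Fin 3 => ℝ) 1).symm
  have e2 : ∫ u, G u = ∫ p : ℝ × (Fin 2 → ℝ),
      G ((MeasurableEquiv.piFinSuccAbove (fun _ : Fin 3 => ℝ) 1).symm p) :=
    (mp.integral_comp' G).symm
  have hint2 : Integrable (fun p : ℝ × (Fin 2 → ℝ) =>
      G ((MeasurableEquiv.piFinSuccAbove (fun _ : Fin 3 => ℝ) 1).symm p)) :=
    (mp.integrable_comp_emb (MeasurableEquiv.measurableEmbedding _)).2 hGint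
  have hform : ∀ (t : ℝ) (w : Fin 2 → ℝ),
      G ((MeasurableEquiv.piFinSuccAbove (fun _ : Fin 3 => ℝ) 1).symm (t, w)) =
      Complex.exp (c₂ / 2 * (t : ℂ) ^ 2) *
       ∏ i, (![fun s : ℝ => Complex.exp (b₁ * (s : ℂ) ^ 2 + (-Complex.I * t) * s + 0),
        fun s : ℝ => Complex.exp (b₃ * (s : ℂ) ^ 2 + (Complex.I * t) * s + 0)] : Fin 2 → ℝ → ℂ) i (w i) := by
    intro t w
    have a0 : (MeasurableEquiv.piFinSuccAbove (fun _ : Fin 3 => ℝ) 1).symm (t, w) 0 = w 0 := rfl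
    have a1 : (MeasurableEquiv.piFinSuccAbove (fun _ : Fin 3 => ℝ) 1).symm (t, w) 1 = t := rfl
    have a2 : (MeasurableEquiv.piFinSuccAbove (fun _ : Fin 3 => ℝ) 1).symm (t, w) 2 = w 1 := rfl
    simp only [hG, a0, a1, a2, Fin.prod_univ_two, Matrix.cons_val_zero, Matrix.cons_val_one]
    rw [← Complex.exp_add, ← Complex.exp_add]
    congr 1
    rw [hb₁, hb₃]
    ring
  have n₁ : b₁ ≠ 0 := by intro h; simp [h] at r₁
  have n₃ : b₃ ≠ 0 := by intro h; simp [h] at r₃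
  have e3 : ∫ u, G u = ∫ t : ℝ, ((π / -b₁) ^ (1 / 2 : ℂ) * (π / -b₃) ^ (1 / 2 : ℂ)) *
      Complex.exp ((c₂ / 2 + (4 * b₁)⁻¹ + (4 * b₃)⁻¹) * (t : ℂ) ^ 2 + 0 * t + 0) := by
    rw [e2, Measure.volume_eq_prod, integral_prod _ hint2]
    refine integral_congr_ae (Eventually.of_forall fun t => ?_)
    simp only [hform]
    rw [integral_const_mul, integral_fin_nat_prod_volume_eq_prod]
    simp only [Fin.prod_univ_two, Matrix.cons_val_zero, Matrix.cons_val_one]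
    rw [integral_cexp_quadratic r₁, integral_cexp_quadratic r₃]
    have : Complex.exp ((c₂ / 2 + (4 * b₁)⁻¹ + (4 * b₃)⁻¹) * (t : ℂ) ^ 2 + 0 * t + 0) =
      Complex.exp (c₂ / 2 * (t : ℂ) ^ 2) * (Complex.exp (0 - (-Complex.I * t) ^ 2 / (4 * b₁)) *
        Complex.exp (0 - (Complex.I * t) ^ 2 / (4 * b₃))) := by
      rw [← Complex.exp_add, ← Complex.exp_add]
      congr 1
      simp only [mul_pow, neg_sq, Complex.I_sq]
      ring
    rw [this]
    ring
  have q₁ : ((4 * b₁)⁻¹).re < 0 := by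
    rw [Complex.inv_re]
    refine div_neg_of_neg_of_pos (by simp; linarith) (Complex.normSq_pos.2 (by simp [n₁]))
  have q₃ : ((4 * b₃)⁻¹).re < 0 := by
    rw [Complex.inv_re]
    refine div_neg_of_neg_of_pos (by simp; linarith) (Complex.normSq_pos.2 (by simp [n₃]))
  have q : (c₂ / 2 + (4 * b₁)⁻¹ + (4 * b₃)⁻¹).re < 0 := by
    rw [Complex.add_re, Complex.add_re]
    have : (c₂ / 2).re < 0 := by simp; linarith
    linarith
  have nq : (c₂ / 2 + (4 * b₁)⁻¹ + (4 * b₃)⁻¹) ≠ 0 := by intro h; rw [h] at q; simp at q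
  have hpi : (π : ℂ) ≠ 0 := by exact_mod_cast Real.pi_ne_zero
  have hp : ∀ b : ℂ, b ≠ 0 → ((π : ℂ) / -b) ^ (1 / 2 : ℂ) ≠ 0 := fun b hb => by
    rw [Complex.cpow_def_of_ne_zero (div_ne_zero hpi (neg_ne_zero.2 hb))]
    exact Complex.exp_ne_zero _
  rw [e1, e3, integral_const_mul, integral_cexp_quadratic q]
  exact mul_ne_zero (mul_ne_zero (hp _ n₁) (hp _ n₃)) (mul_ne_zero (hp _ nq) (Complex.exp_ne_zero _))

lemma integrable_exp_abs {k : ℝ} (hk : 0 < k) :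
    Integrable (fun u : ℝ => Real.exp (-k * (|u| - 1))) := by
  have e : (fun u : ℝ => Real.exp (-k * (|u| - 1))) =
      fun u => Real.exp (-k * |u|) * Real.exp k := by
    funext u
    rw [← Real.exp_add]
    congr 1
    ring
  rw [e]
  refine Integrable.mul_const ?_ _
  rw [← integrableOn_univ, ← Set.Iic_union_Ioi (a := (0:ℝ)), integrableOn_union]
  constructor
  · refine (integrableOn_exp_mul_Iic hk 0).congr_fun (fun u hu => ?_) measurableSet_Iic
    simp [abs_of_nonpos (Set.mem_Iic.1 hu)]
  · refine (integrableOn_exp_mul_Ioi (neg_neg_of_pos hk) 0).congr_fun (fun u hu => ?_)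
      measurableSet_Ioi
    simp [abs_of_pos (Set.mem_Ioi.1 hu)]

lemma laplace {A₁ A₂ A₃ : ℝ → ℂ} {c₁ c₂ c₃ : ℂ} (h₁ : Phase A₁ c₁) (h₂ : Phase A₂ c₂)
    (h₃ : Phase A₃ c₃) :
    ∃ ρ : ℂ, ρ ≠ 0 ∧ Tendsto (fun s : ℝ => (s : ℂ) ^ 3 *
      ∫ v : EuclideanSpace ℝ (Fin 3), Complex.exp ((s : ℂ) ^ 2 *
      (Complex.I * ((v 0 : ℂ) ^ 2 - v 0 * v 1 + v 1 * v 2 + (v 2 : ℂ) ^ 2 / 2) +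
        (A₁ (v 0) + A₂ (v 1) + A₃ (v 2))))) atTop (nhds ρ) := by
  refine ⟨_, gauss_ne_zero h₁.neg h₂.neg h₃.neg, ?_⟩
  obtain ⟨k₁, hk₁, b₁⟩ := h₁.bound
  obtain ⟨k₂, hk₂, b₂⟩ := h₂.bound
  obtain ⟨k₃, hk₃, b₃⟩ := h₃.bound
  have cont₁ := h₁.continuous
  have cont₂ := h₂.continuous
  have cont₃ := h₃.continuous
  have hlim : Tendsto (fun s : ℝ =>
      ∫ u : EuclideanSpace ℝ (Fin 3), Complex.exp
      (Complex.I * ((u 0 : ℂ) ^ 2 - u 0 * u 1 + u 1 * u 2 + (u 2 : ℂ) ^ 2 / 2) +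
        ((s : ℂ) ^ 2 * A₁ (s⁻¹ * u 0) + (s : ℂ) ^ 2 * A₂ (s⁻¹ * u 1)
          + (s : ℂ) ^ 2 * A₃ (s⁻¹ * u 2)))) atTop
      (nhds (∫ u : EuclideanSpace ℝ (Fin 3), Complex.exp
      (Complex.I * ((u 0 : ℂ) ^ 2 - u 0 * u 1 + u 1 * u 2 + (u 2 : ℂ) ^ 2 / 2) +
        (c₁ / 2 * (u 0 : ℂ) ^ 2 + c₂ / 2 * (u 1 : ℂ) ^ 2 + c₃ / 2 * (u 2 : ℂ) ^ 2)))) := by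
    refine tendsto_integral_filter_of_dominated_convergence
      (fun u : EuclideanSpace ℝ (Fin 3) => Real.exp (-k₁ * (|u 0| - 1)) *
        Real.exp (-k₂ * (|u 1| - 1)) * Real.exp (-k₃ * (|u 2| - 1))) ?_ ?_ ?_ ?_
    · refine Eventually.of_forall fun s => Continuous.aestronglyMeasurable ?_
      fun_prop
    · filter_upwards [b₁, b₂, b₃] with s b₁ b₂ b₃
      refine Eventually.of_forall fun u => ?_
      rw [Complex.norm_exp, ← Real.exp_add, ← Real.exp_add]
      refine Real.exp_le_exp.2 ?_
      have e0 : (Complex.I * ((u 0 : ℂ) ^ 2 - u 0 * u 1 + u 1 * u 2 + (u 2 : ℂ) ^ 2 / 2)).re = 0 := by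
        rw [show ((u 0 : ℂ) ^ 2 - u 0 * u 1 + u 1 * u 2 + (u 2 : ℂ) ^ 2 / 2) =
          ((u 0 ^ 2 - u 0 * u 1 + u 1 * u 2 + u 2 ^ 2 / 2 : ℝ) : ℂ) by push_cast; ring]
        simp only [Complex.I_mul_re, Complex.ofReal_im, neg_zero]
      have e1 : ∀ z : ℂ, ((s : ℂ) ^ 2 * z).re = s ^ 2 * z.re := fun z => by
        rw [← Complex.ofReal_pow, Complex.re_ofReal_mul]
      rw [Complex.add_re, e0, Complex.add_re, Complex.add_re, e1, e1, e1]
      linarith [b₁ (u 0), b₂ (u 1), b₃ (u 2)]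
    · have hprod : Integrable (fun u : Fin 3 → ℝ => ∏ i,
          (![fun t : ℝ => Real.exp (-k₁ * (|t| - 1)), fun t : ℝ => Real.exp (-k₂ * (|t| - 1)),
            fun t : ℝ => Real.exp (-k₃ * (|t| - 1))] : Fin 3 → ℝ → ℝ) i (u i)) := by
        apply Integrable.fintype_prod
        intro i
        fin_cases i
        · exact integrable_exp_abs hk₁
        · exact integrable_exp_abs hk₂
        · exact integrable_exp_abs hk₃
      have := ((EuclideanSpace.volume_preserving_symm_measurableEquiv_toLp
        (Fin 3)).integrable_comp_emb (MeasurableEquiv.measurableEmbedding _)).2 hprod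
      refine this.congr (Eventually.of_forall fun u => ?_)
      simp [Fin.prod_univ_three]
    · refine Eventually.of_forall fun u => ?_
      refine (Complex.continuous_exp.tendsto _).comp ?_
      exact (((h₁.tendsto (u 0)).add (h₂.tendsto (u 1))).add (h₃.tendsto (u 2))).const_add _
  refine hlim.congr' ?_
  filter_upwards [eventually_gt_atTop 0] with s hs
  have hs0 : (s : ℂ) ≠ 0 := by exact_mod_cast hs.ne'
  have := Measure.integral_comp_smul (volume : Measure (EuclideanSpace ℝ (Fin 3)))
    (fun v : EuclideanSpace ℝ (Fin 3) => Complex.exp ((s : ℂ) ^ 2 *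
      (Complex.I * ((v 0 : ℂ) ^ 2 - v 0 * v 1 + v 1 * v 2 + (v 2 : ℂ) ^ 2 / 2) +
        (A₁ (v 0) + A₂ (v 1) + A₃ (v 2))))) s⁻¹
  have hR : |((s⁻¹) ^ Module.finrank ℝ (EuclideanSpace ℝ (Fin 3)))⁻¹| = s ^ 3 := by
    simp [abs_of_pos hs]
  rw [hR, Complex.real_smul, Complex.ofReal_pow] at this
  rw [← this]
  refine integral_congr_ae (Eventually.of_forall fun u => ?_)
  simp only [PiLp.smul_apply, smul_eq_mul]
  congr 1
  push_cast
  field_simp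

lemma potSlice_expand (d₁ d₂ d₃ : ℝ)
    (hd₁ : Real.sin d₁ ≠ 0) (hd₂ : Real.sin d₂ ≠ 0) (hd₃ : Real.sin d₃ ≠ 0)
    (x₀ : EuclideanSpace ℝ (Fin 3))
    (hcrit :
      deriv (fun w => pot w ((x₀ 1 : ℂ) + (d₂ : ℂ) * Complex.I)
          ((x₀ 2 : ℂ) + (d₃ : ℂ) * Complex.I))
        ((x₀ 0 : ℂ) + (d₁ : ℂ) * Complex.I) = 0 ∧
      deriv (fun w => pot ((x₀ 0 : ℂ) + (d₁ : ℂ) * Complex.I) w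
          ((x₀ 2 : ℂ) + (d₃ : ℂ) * Complex.I))
        ((x₀ 1 : ℂ) + (d₂ : ℂ) * Complex.I) = 0 ∧
      deriv (fun w => pot ((x₀ 0 : ℂ) + (d₁ : ℂ) * Complex.I)
          ((x₀ 1 : ℂ) + (d₂ : ℂ) * Complex.I) w)
        ((x₀ 2 : ℂ) + (d₃ : ℂ) * Complex.I) = 0)
    (v : EuclideanSpace ℝ (Fin 3)) :
    potSlice d₁ d₂ d₃ (x₀ + v) = potSlice d₁ d₂ d₃ x₀ +
      (Complex.I * ((v 0 : ℂ) ^ 2 - v 0 * v 1 + v 1 * v 2 + (v 2 : ℂ) ^ 2 / 2) +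
      ((((1:ℝ) : ℂ) * Complex.I *
      (Li2 (-Complex.exp ((x₀ 0 + d₁ * Complex.I) + v 0)) - Li2 (-Complex.exp (x₀ 0 + d₁ * Complex.I)) +
        v 0 * Complex.log (1 + Complex.exp (x₀ 0 + d₁ * Complex.I)))) +
      (((-1:ℝ) : ℂ) * Complex.I *
      (Li2 (-Complex.exp ((x₀ 1 + d₂ * Complex.I) + v 1)) - Li2 (-Complex.exp (x₀ 1 + d₂ * Complex.I)) +
        v 1 * Complex.log (1 + Complex.exp (x₀ 1 + d₂ * Complex.I)))) +
      (((3:ℝ) : ℂ) * Complex.I *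
      (Li2 (-Complex.exp ((x₀ 2 + d₃ * Complex.I) + v 2)) - Li2 (-Complex.exp (x₀ 2 + d₃ * Complex.I)) +
        v 2 * Complex.log (1 + Complex.exp (x₀ 2 + d₃ * Complex.I)))))) := by
  obtain ⟨g₁, g₂, g₃⟩ := hcrit
  have s₁ : Real.sin ((x₀ 0 : ℂ) + (d₁ : ℂ) * Complex.I).im ≠ 0 := by simpa using hd₁
  have s₂ : Real.sin ((x₀ 1 : ℂ) + (d₂ : ℂ) * Complex.I).im ≠ 0 := by simpa using hd₂
  have s₃ : Real.sin ((x₀ 2 : ℂ) + (d₃ : ℂ) * Complex.I).im ≠ 0 := by simpa using hd₃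
  have a₁ : ((((x₀ + v) 0 : ℝ) : ℂ) + d₁ * Complex.I) = ((x₀ 0 : ℂ) + (d₁ : ℂ) * Complex.I) + v 0 := by
    rw [PiLp.add_apply]; push_cast; ring
  have a₂ : ((((x₀ + v) 1 : ℝ) : ℂ) + d₂ * Complex.I) = ((x₀ 1 : ℂ) + (d₂ : ℂ) * Complex.I) + v 1 := by
    rw [PiLp.add_apply]; push_cast; ring
  have a₃ : ((((x₀ + v) 2 : ℝ) : ℂ) + d₃ * Complex.I) = ((x₀ 2 : ℂ) + (d₃ : ℂ) * Complex.I) + v 2 := by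
    rw [PiLp.add_apply]; push_cast; ring
  unfold potSlice
  rw [a₁, a₂, a₃]
  generalize ((x₀ 0 : ℂ) + (d₁ : ℂ) * Complex.I) = y₁ at *
  generalize ((x₀ 1 : ℂ) + (d₂ : ℂ) * Complex.I) = y₂ at *
  generalize ((x₀ 2 : ℂ) + (d₃ : ℂ) * Complex.I) = y₃ at *
  generalize (v 0 : ℂ) = v₁
  generalize (v 1 : ℂ) = v₂
  generalize (v 2 : ℂ) = v₃
  have D₁ : HasDerivAt (fun w => pot w y₂ y₃)
      (Complex.I * (2 * y₁ - y₂) - π + Complex.I * (-Complex.log (1 + Complex.exp y₁))) y₁ := by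
    have i := hasDerivAt_id y₁
    have q := ((((i.pow 2).sub (i.mul_const y₂)).add_const (y₂ * y₃)).add_const
      (y₃ ^ 2 / 2)).const_mul Complex.I
    have l := (i.const_mul (-(π : ℂ))).add_const ((π : ℂ) * y₃)
    have t := (((q.add l).add ((hasDerivAt_Li2_exp s₁).const_mul Complex.I)).sub_const
      (Complex.I * Li2 (-Complex.exp y₂))).add_const (3 * Complex.I * Li2 (-Complex.exp y₃))
    refine (t.congr_deriv ?_)
    simp
    ring
  have D₂ : HasDerivAt (fun w => pot y₁ w y₃)
      (Complex.I * (-y₁ + y₃) - Complex.I * (-Complex.log (1 + Complex.exp y₂))) y₂ := by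
    have i := hasDerivAt_id y₂
    have q := ((((i.const_mul y₁).const_sub (y₁ ^ 2)).add (i.mul_const y₃)).add_const
      (y₃ ^ 2 / 2)).const_mul Complex.I
    have t := (((q.add_const (-(π : ℂ) * y₁ + (π : ℂ) * y₃)).add_const
      (Complex.I * Li2 (-Complex.exp y₁))).sub
        ((hasDerivAt_Li2_exp s₂).const_mul Complex.I)).add_const
        (3 * Complex.I * Li2 (-Complex.exp y₃))
    refine (t.congr_deriv ?_)
    simp
  have D₃ : HasDerivAt (fun w => pot y₁ y₂ w)
      (Complex.I * (y₂ + y₃) + π + 3 * Complex.I * (-Complex.log (1 + Complex.exp y₃))) y₃ := by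
    have i := hasDerivAt_id y₃
    have q := (((i.const_mul y₂).const_add (y₁ ^ 2 - y₁ * y₂)).add
      ((i.pow 2).div_const 2)).const_mul Complex.I
    have l := (i.const_mul (π : ℂ)).const_add (-(π : ℂ) * y₁)
    have t := (((q.add l).add_const (Complex.I * Li2 (-Complex.exp y₁))).sub_const
      (Complex.I * Li2 (-Complex.exp y₂))).add
        ((hasDerivAt_Li2_exp s₃).const_mul (3 * Complex.I))
    refine (t.congr_deriv ?_)
    simp
  rw [D₁.deriv] at g₁
  rw [D₂.deriv] at g₂
  rw [D₃.deriv] at g₃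
  unfold pot
  push_cast
  linear_combination v₁ * g₁ + v₂ * g₂ + v₃ * g₃

/-- saddle point asymptotics. If `∇S(y⁰) = 0` with
`y⁰ = x⁰ + i d`, then `∫_{ℝ³} e^{λ S(x+id)} dx = ρ λ^{-3/2} e^{λ S(y⁰)}(1+o(1))`
for some `ρ ≠ 0`; in particular `(1/λ) log |∫| → Re S(y⁰)` as `λ → ∞`. -/
theorem saddle_point_asymptotics (d₁ d₂ d₃ : ℝ)
    (hd₁ : d₁ ∈ Set.Ioo (-π) 0) (hd₂ : d₂ ∈ Set.Ioo 0 π)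
    (hd₃ : d₃ ∈ Set.Ioo (-π) 0) (x₀ : EuclideanSpace ℝ (Fin 3))
    (hcrit :
      deriv (fun w => pot w ((x₀ 1 : ℂ) + (d₂ : ℂ) * Complex.I)
          ((x₀ 2 : ℂ) + (d₃ : ℂ) * Complex.I))
        ((x₀ 0 : ℂ) + (d₁ : ℂ) * Complex.I) = 0 ∧
      deriv (fun w => pot ((x₀ 0 : ℂ) + (d₁ : ℂ) * Complex.I) w
          ((x₀ 2 : ℂ) + (d₃ : ℂ) * Complex.I))
        ((x₀ 1 : ℂ) + (d₂ : ℂ) * Complex.I) = 0 ∧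
      deriv (fun w => pot ((x₀ 0 : ℂ) + (d₁ : ℂ) * Complex.I)
          ((x₀ 1 : ℂ) + (d₂ : ℂ) * Complex.I) w)
        ((x₀ 2 : ℂ) + (d₃ : ℂ) * Complex.I) = 0) :
    (∃ ρ : ℂ, ρ ≠ 0 ∧ ∃ ε : ℝ → ℂ, Tendsto ε atTop (nhds 0) ∧
      ∀ lam : ℝ, 0 < lam →
        (∫ x : EuclideanSpace ℝ (Fin 3),
            Complex.exp ((lam : ℂ) * potSlice d₁ d₂ d₃ x)) =
          ρ * ((lam ^ (-(3:ℝ)/2) : ℝ) : ℂ) *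
            Complex.exp ((lam : ℂ) * potSlice d₁ d₂ d₃ x₀) * (1 + ε lam)) ∧
    Tendsto (fun lam : ℝ =>
        (1/lam) * Real.log ‖∫ x : EuclideanSpace ℝ (Fin 3),
          Complex.exp ((lam : ℂ) * potSlice d₁ d₂ d₃ x)‖)
      atTop (nhds (potSlice d₁ d₂ d₃ x₀).re) := by
  have s₁ : Real.sin d₁ < 0 := Real.sin_neg_of_neg_of_neg_pi_lt hd₁.2 hd₁.1
  have s₂ : 0 < Real.sin d₂ := Real.sin_pos_of_pos_of_lt_pi hd₂.1 hd₂.2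
  have s₃ : Real.sin d₃ < 0 := Real.sin_neg_of_neg_of_neg_pi_lt hd₃.2 hd₃.1
  obtain ⟨ρ, hρ, hlim⟩ := laplace
    (Phase_of 1 (x₀ 0) d₁ (by linarith)) (Phase_of (-1) (x₀ 1) d₂ (by linarith))
    (Phase_of 3 (x₀ 2) d₃ (by linarith))
  have hexp := potSlice_expand d₁ d₂ d₃ s₁.ne s₂.ne' s₃.ne x₀ hcrit
  set I : ℝ → ℂ := fun lam => ∫ x : EuclideanSpace ℝ (Fin 3),
    Complex.exp ((lam : ℂ) * potSlice d₁ d₂ d₃ x) with hI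
  set P := potSlice d₁ d₂ d₃ x₀ with hP
  -- normalised integral
  set N : ℝ → ℂ := fun lam => I lam / (((lam ^ (-(3:ℝ)/2) : ℝ) : ℂ) * Complex.exp ((lam : ℂ) * P))
    with hN
  have hne : ∀ lam : ℝ, 0 < lam →
      ((lam ^ (-(3:ℝ)/2) : ℝ) : ℂ) * Complex.exp ((lam : ℂ) * P) ≠ 0 := fun lam hl =>
    mul_ne_zero (by exact_mod_cast (Real.rpow_pos_of_pos hl _).ne') (Complex.exp_ne_zero _)
  have hNlim : Tendsto N atTop (nhds ρ) := by
    have hs : Tendsto (fun lam : ℝ => √lam) atTop atTop := Real.tendsto_sqrt_atTop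
    refine (hlim.comp hs).congr' ?_
    filter_upwards [eventually_gt_atTop 0] with lam hl
    have hsq : ((√lam : ℝ) : ℂ) ^ 2 = lam := by
      rw [← Complex.ofReal_pow, Real.sq_sqrt hl.le]
    have hcube : (((√lam : ℝ) : ℂ) ^ 3) * ((lam ^ (-(3:ℝ)/2) : ℝ) : ℂ) = 1 := by
      rw [← Complex.ofReal_pow, ← Complex.ofReal_mul, Real.sqrt_eq_rpow, ← Real.rpow_natCast,
        ← Real.rpow_mul hl.le, ← Real.rpow_add hl]
      norm_num
    have hshift : I lam = Complex.exp ((lam : ℂ) * P) * ∫ v : EuclideanSpace ℝ (Fin 3),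
        Complex.exp ((lam : ℂ) * (potSlice d₁ d₂ d₃ (x₀ + v) - P)) := by
      rw [← integral_const_mul, hI]
      simp only
      rw [← integral_add_left_eq_self _ x₀]
      refine integral_congr_ae (Eventually.of_forall fun v => ?_)
      simp only
      rw [← Complex.exp_add]
      congr 1
      ring
    simp only [Function.comp_def]
    rw [hN]
    simp only
    rw [eq_div_iff (hne lam hl), hshift]
    simp only [hexp, add_sub_cancel_left, hsq]
    linear_combination (Complex.exp ((lam : ℂ) * P) * ∫ v : EuclideanSpace ℝ (Fin 3), _) * hcube
  have hIN : ∀ lam : ℝ, 0 < lam → I lam =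
      N lam * (((lam ^ (-(3:ℝ)/2) : ℝ) : ℂ) * Complex.exp ((lam : ℂ) * P)) := fun lam hl => by
    rw [hN]
    simp only
    rw [div_mul_cancel₀ _ (hne lam hl)]
  refine ⟨⟨ρ, hρ, fun lam => N lam / ρ - 1, ?_, ?_⟩, ?_⟩
  · have := (hNlim.div_const ρ).sub_const 1
    rwa [div_self hρ, sub_self] at this
  · intro lam hl
    change I lam = _
    rw [hIN lam hl]
    field_simp
    ring
  · change Tendsto (fun lam : ℝ => (1/lam) * Real.log ‖I lam‖) atTop _
    have hlog : Tendsto (fun lam : ℝ => Real.log ‖N lam‖) atTop (nhds (Real.log ‖ρ‖)) :=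
      hNlim.norm.log (norm_ne_zero_iff.2 hρ)
    have t1 : Tendsto (fun lam : ℝ => lam⁻¹ * Real.log ‖N lam‖) atTop (nhds 0) := by
      simpa using tendsto_inv_atTop_zero.mul hlog
    have t2 : Tendsto (fun lam : ℝ => Real.log lam / lam) atTop (nhds 0) :=
      Real.isLittleO_log_id_atTop.tendsto_div_nhds_zero
    have t3 := (t1.add (t2.const_mul (-(3:ℝ)/2))).add_const P.re
    simp only [mul_zero, zero_add] at t3
    refine t3.congr' ?_
    filter_upwards [eventually_gt_atTop 0, hNlim.eventually_ne hρ] with lam hl hn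
    have hpos := Real.rpow_pos_of_pos hl (-(3:ℝ)/2)
    rw [hIN lam hl, norm_mul, norm_mul, Complex.norm_exp, Complex.norm_real,
      Real.norm_of_nonneg hpos.le, Real.log_mul (norm_ne_zero_iff.2 hn)
        (mul_ne_zero hpos.ne' (Real.exp_pos _).ne'),
      Real.log_mul hpos.ne' (Real.exp_pos _).ne', Real.log_exp, Real.log_rpow hl,
      Complex.re_ofReal_mul]
    field_simp
    ring
end

section
/- For every δ ∈ (0, π/2) there exists a constant C_δ > 0 such that for all b ∈ (0, √(δ/(2(π-δ)))) and all y ∈ ℂ with Im y ∈ [-(π-δ), -δ] ∪ [δ, π-δ], one has |Re( (-i/(2πb²))·Li₂(-e^{y(1+b²)}) - (-i/(2πb²))·(1+b²)²·Li₂(-e^{y}) )| ≤ C_δ. -/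
open Real

theorem low_aux (η : ℝ) (h0 : 0 < η) (h1 : η < π) (w : ℂ) (hw : |w.im| ≤ π - η) (t : ℝ)
    (ht : 0 ≤ t) : Real.sin η ≤ ‖1 + Complex.exp w * t‖ := by
  have hs : 0 ≤ Real.sin η := (Real.sin_pos_of_pos_of_lt_pi h0 h1).le
  have hc : -Real.cos η ≤ Real.cos w.im := by
    rw [← Real.cos_pi_sub, ← Real.cos_abs w.im]
    exact Real.cos_le_cos_of_nonneg_of_le_pi (abs_nonneg _) (by linarith) hw
  refine (pow_le_pow_iff_left₀ hs (norm_nonneg _) two_ne_zero).1 ?_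
  rw [← Complex.normSq_eq_norm_sq, Complex.normSq_apply]
  simp only [Complex.add_re, Complex.one_re, Complex.mul_re, Complex.exp_re, Complex.ofReal_re,
    Complex.ofReal_im, Complex.add_im, Complex.one_im, Complex.mul_im, Complex.exp_im]
  have hr : 0 ≤ Real.exp w.re * t := by positivity
  generalize hR : Real.exp w.re * t = r at hr
  have e1 := Real.sin_sq_add_cos_sq w.im
  have e2 := Real.sin_sq_add_cos_sq η
  have : (1 + (Real.exp w.re * Real.cos w.im * t - Real.exp w.re * Real.sin w.im * 0)) *
      (1 + (Real.exp w.re * Real.cos w.im * t - Real.exp w.re * Real.sin w.im * 0)) +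
      (0 + (Real.exp w.re * Real.cos w.im * 0 + Real.exp w.re * Real.sin w.im * t)) *
      (0 + (Real.exp w.re * Real.cos w.im * 0 + Real.exp w.re * Real.sin w.im * t))
      = 1 + 2 * r * Real.cos w.im + r ^ 2 * (Real.sin w.im ^ 2 + Real.cos w.im ^ 2) := by
    rw [← hR]; ring
  rw [this, e1]
  nlinarith [sq_nonneg (r - Real.cos η), mul_le_mul_of_nonneg_left hc hr]

theorem slit_aux (w : ℂ) (hw : |w.im| < π) (t : ℝ)
    (ht : 0 ≤ t) : 1 + Complex.exp w * t ∈ Complex.slitPlane := by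
  rw [Complex.mem_slitPlane_iff]
  by_cases h : w.im = 0
  · left
    simp only [Complex.add_re, Complex.one_re, Complex.mul_re, Complex.exp_re, Complex.ofReal_re,
      Complex.ofReal_im, h]
    simp
    positivity
  · rcases ht.eq_or_lt with h' | h'
    · left; simp [← h']
    · right
      simp only [Complex.add_im, Complex.one_im, Complex.mul_im, Complex.exp_im,
        Complex.ofReal_re, Complex.ofReal_im]
      have : Real.sin w.im ≠ 0 := by
        intro hs
        rw [Real.sin_eq_zero_iff_of_lt_of_lt (abs_lt.1 hw).1 (abs_lt.1 hw).2] at hs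
        exact h hs
      simp [this, h'.ne']

theorem logDeriv_aux (w : ℂ) (hw : |w.im| < π) (t : ℝ) (ht : 0 ≤ t) :
    HasDerivAt (fun t : ℝ => Complex.log (1 + Complex.exp w * t))
      (Complex.exp w / (1 + Complex.exp w * t)) t := by
  have h1 : HasDerivAt (fun t : ℂ => 1 + Complex.exp w * t) (Complex.exp w) (t : ℂ) := by
    simpa using ((hasDerivAt_id (t : ℂ)).const_mul (Complex.exp w)).const_add 1
  exact (h1.clog (slit_aux w hw t ht)).comp_ofReal

theorem logBound_aux (η : ℝ) (h0 : 0 < η) (h1 : η < π) (w : ℂ) (hw : |w.im| ≤ π - η) (t : ℝ)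
    (ht : 0 ≤ t) : ‖Complex.log (1 + Complex.exp w * t)‖ ≤ Real.exp w.re / Real.sin η * t := by
  have hs : 0 < Real.sin η := (Real.sin_pos_of_pos_of_lt_pi h0 h1)
  have := (convex_Ici (0:ℝ)).norm_image_sub_le_of_norm_hasDerivWithin_le
    (f := fun t : ℝ => Complex.log (1 + Complex.exp w * t))
    (f' := fun t : ℝ => Complex.exp w / (1 + Complex.exp w * t))
    (C := Real.exp w.re / Real.sin η) (x := 0) (y := t)
    (fun x hx => (logDeriv_aux w (by linarith) x hx).hasDerivWithinAt)
    (fun x hx => by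
      rw [norm_div, Complex.norm_exp]
      gcongr
      exact low_aux η h0 h1 w hw x hx) Set.self_mem_Ici ht
  simpa [abs_of_nonneg ht] using this

/-- the rescaled dilogarithm -/
noncomputable def FF (w : ℂ) : ℂ := Li2 (-Complex.exp w)

theorem FF_eq (w : ℂ) :
    FF w = -∫ t in (0:ℝ)..1, Complex.log (1 + Complex.exp w * (t : ℂ)) / (t : ℂ) := by
  simp [FF, Li2, sub_neg_eq_add]

theorem FF_bound (η : ℝ) (h0 : 0 < η) (h1 : η < π) (w : ℂ) (hw : |w.im| ≤ π - η) :
    ‖FF w‖ ≤ Real.exp w.re / Real.sin η := by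
  rw [FF_eq, norm_neg]
  have := intervalIntegral.norm_integral_le_of_norm_le_const (a := (0:ℝ)) (b := 1)
    (f := fun t : ℝ => Complex.log (1 + Complex.exp w * (t : ℂ)) / (t : ℂ))
    (C := Real.exp w.re / Real.sin η) (by
      intro t ht
      rw [Set.uIoc_of_le zero_le_one] at ht
      rw [norm_div, Complex.norm_real, Real.norm_of_nonneg ht.1.le, div_le_iff₀ ht.1]
      exact logBound_aux η h0 h1 w hw t ht.1.le)
  simpa using this

theorem meas_aux (w : ℂ) : Measurable
    (fun t : ℝ => Complex.log (1 + Complex.exp w * (t : ℂ)) / (t : ℂ)) := by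
  fun_prop

theorem FF_deriv (η : ℝ) (h0 : 0 < η) (h1 : η < π) (w : ℂ) (hw : |w.im| ≤ π - η) :
    HasDerivAt FF (-Complex.log (1 + Complex.exp w)) w := by
  have hs : 0 < Real.sin (η/2) := (Real.sin_pos_of_pos_of_lt_pi (by linarith) (by linarith))
  have hball : ∀ x ∈ Metric.ball w (η/2), |x.im| ≤ π - η/2 ∧ x.re ≤ w.re + η := by
    intro x hx
    rw [mem_ball_iff_norm] at hx
    have a := Complex.abs_im_le_norm (x - w)
    have b := Complex.abs_re_le_norm (x - w)
    simp only [Complex.sub_im, Complex.sub_re] at a b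
    have c := abs_sub_abs_le_abs_sub x.im w.im
    have d := le_abs_self (x.re - w.re)
    constructor <;> linarith
  have key := intervalIntegral.hasDerivAt_integral_of_dominated_loc_of_deriv_le
    (μ := MeasureTheory.volume) (a := (0:ℝ)) (b := 1)
    (F := fun w t => Complex.log (1 + Complex.exp w * ((t:ℝ) : ℂ)) / (t : ℂ))
    (F' := fun w t => Complex.exp w / (1 + Complex.exp w * ((t:ℝ) : ℂ)))
    (x₀ := w) (s := Metric.ball w (η/2))
    (bound := fun _ => Real.exp (w.re + η) / Real.sin (η/2))
    (Metric.ball_mem_nhds _ (by linarith))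
    (Filter.Eventually.of_forall fun x => (meas_aux x).aestronglyMeasurable)
    (by
      refine (intervalIntegrable_const (c := Real.exp w.re / Real.sin η)).mono_fun
        (meas_aux w).aestronglyMeasurable ?_
      rw [Filter.EventuallyLE, MeasureTheory.ae_restrict_iff' measurableSet_uIoc]
      refine Filter.Eventually.of_forall fun t ht => ?_
      rw [Set.uIoc_of_le zero_le_one] at ht
      refine le_trans ?_ (le_abs_self _)
      rw [norm_div, Complex.norm_real, Real.norm_of_nonneg ht.1.le, div_le_iff₀ ht.1]
      exact logBound_aux η h0 h1 w hw t ht.1.le)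
    (by
      apply Measurable.aestronglyMeasurable
      fun_prop)
    (by
      refine Filter.Eventually.of_forall fun t ht x hx => ?_
      rw [Set.uIoc_of_le zero_le_one] at ht
      rw [norm_div, Complex.norm_exp]
      gcongr
      · exact (hball x hx).2
      · exact low_aux (η/2) (by linarith) (by linarith) x (hball x hx).1 t ht.1.le)
    intervalIntegrable_const
    (by
      refine Filter.Eventually.of_forall fun t ht x hx => ?_
      rw [Set.uIoc_of_le zero_le_one] at ht
      have h : HasDerivAt (fun x => 1 + Complex.exp x * (t:ℂ)) (Complex.exp x * t) x :=
        ((Complex.hasDerivAt_exp x).mul_const _).const_add 1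
      have h2 := (h.clog (slit_aux x (by linarith [(hball x hx).1]) t ht.1.le)).div_const (t:ℂ)
      have ht' : (t:ℂ) ≠ 0 := by exact_mod_cast ht.1.ne'
      refine h2.congr_deriv ?_
      field_simp)
  have hint : ∫ t in (0:ℝ)..1, Complex.exp w / (1 + Complex.exp w * ((t:ℝ) : ℂ))
      = Complex.log (1 + Complex.exp w) := by
    rw [intervalIntegral.integral_eq_sub_of_hasDerivAt
      (f := fun t : ℝ => Complex.log (1 + Complex.exp w * t))]
    · simp
    · intro t ht
      rw [Set.uIcc_of_le zero_le_one] at ht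
      exact logDeriv_aux w (by linarith) t ht.1
    · apply ContinuousOn.intervalIntegrable
      intro t ht
      rw [Set.uIcc_of_le zero_le_one] at ht
      have := Complex.slitPlane_ne_zero (slit_aux w (by linarith) t ht.1)
      apply ContinuousAt.continuousWithinAt
      fun_prop (disch := exact this)
  have k2 := key.2.neg
  rw [hint] at k2
  refine k2.congr_of_eventuallyEq (Filter.Eventually.of_forall fun x => ?_)
  simp [FF_eq]

/-- the closed strip -/
def SS (η : ℝ) : Set ℂ := {w | |w.im| ≤ π - η}

theorem SS_convex (η : ℝ) : Convex ℝ (SS η) := by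
  have : SS η = Complex.imLm ⁻¹' (Set.Icc (-(π-η)) (π-η)) := by
    ext w; simp [SS, abs_le]
  rw [this]
  exact (convex_Icc _ _).linear_preimage _

theorem SS_const (η : ℝ) (h1 : η < π) (f : ℂ → ℂ) (hf : ∀ w ∈ SS η, HasDerivAt f 0 w)
    (w : ℂ) (hw : w ∈ SS η) : f w = f 0 := by
  have := (SS_convex η).norm_image_sub_le_of_norm_hasDerivWithin_le (𝕜 := ℂ)
    (f := f) (f' := fun _ => 0)
    (C := 0) (x := 0) (y := w) (fun x hx => (hf x hx).hasDerivWithinAt) (by simp)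
    (by simp [SS]; linarith) hw
  simpa [sub_eq_zero] using this

theorem slit_one (w : ℂ) (hw : |w.im| < π) : 1 + Complex.exp w ∈ Complex.slitPlane := by
  simpa using slit_aux w hw 1 zero_le_one

theorem log_refl (η : ℝ) (h0 : 0 < η) (h1 : η < π) (w : ℂ) (hw : w ∈ SS η) :
    Complex.log (1 + Complex.exp w) = w + Complex.log (1 + Complex.exp (-w)) := by
  have := SS_const η h1
    (fun w => Complex.log (1 + Complex.exp w) - Complex.log (1 + Complex.exp (-w)) - w) (by
      intro w hw
      have hw' : |w.im| < π := by have : |w.im| ≤ π - η := hw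
                                  linarith
      have s1 := slit_one w hw'
      have s2 := slit_one (-w) (by simpa using hw')
      have d1 := ((Complex.hasDerivAt_exp w).const_add 1).clog s1
      have d2 := (((hasDerivAt_id w).neg.cexp).const_add 1).clog s2
      refine ((d1.sub d2).sub (hasDerivAt_id w)).congr_deriv ?_
      have n1 := Complex.slitPlane_ne_zero s1
      have n2 := Complex.slitPlane_ne_zero s2
      simp only [id, Pi.neg_apply]
      rw [Complex.exp_neg] at n2 ⊢
      have n3 := Complex.exp_ne_zero w
      have n4 : Complex.exp w + 1 ≠ 0 := by rwa [add_comm]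
      field_simp
      ring) w hw
  simp at this
  linear_combination this

theorem FF_refl (η : ℝ) (h0 : 0 < η) (h1 : η < π) (w : ℂ) (hw : w ∈ SS η) :
    FF w + FF (-w) + w ^ 2 / 2 = 2 * FF 0 := by
  have := SS_const η h1
    (fun w => FF w + FF (-w) + w ^ 2 / 2) (by
      intro w hw
      have hw' : (-w) ∈ SS η := by simpa [SS] using hw
      have d1 := FF_deriv η h0 h1 w hw
      have d2 := (FF_deriv η h0 h1 (-w) hw').comp w (hasDerivAt_id w).neg
      have d3 := ((hasDerivAt_id w).pow 2).div_const 2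
      refine ((d1.add d2).add d3).congr_deriv ?_
      rw [log_refl η h0 h1 w hw]
      simp) w hw
  simp at this
  rw [this]; ring

/-- The derivative numerator. -/
noncomputable def GG (w : ℂ) : ℂ := w * (-Complex.log (1 + Complex.exp w)) - 2 * FF w

theorem GG_left (η : ℝ) (h0 : 0 < η) (h1 : η < π) (w : ℂ) (hw : w ∈ SS η) (hre : w.re ≤ 0) :
    ‖GG w‖ ≤ (3 + π) / Real.sin η := by
  have hs : 0 < Real.sin η := (Real.sin_pos_of_pos_of_lt_pi h0 h1)
  have b1 := logBound_aux η h0 h1 w hw 1 zero_le_one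
  have b2 := FF_bound η h0 h1 w hw
  simp only [Complex.ofReal_one, mul_one] at b1
  have b3 : ‖w‖ ≤ -w.re + π := by
    have := Complex.norm_le_abs_re_add_abs_im w
    rw [abs_of_nonpos hre] at this
    have h : |w.im| ≤ π - η := hw
    linarith
  have b4 : (-w.re) * Real.exp w.re ≤ 1 := by
    have := Real.add_one_le_exp (-w.re)
    calc (-w.re) * Real.exp w.re ≤ Real.exp (-w.re) * Real.exp w.re := by
          gcongr; linarith
      _ = 1 := by rw [← Real.exp_add]; simp
  have b5 : Real.exp w.re ≤ 1 := Real.exp_le_one_iff.2 hre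
  calc ‖GG w‖ ≤ ‖w‖ * ‖Complex.log (1 + Complex.exp w)‖ + 2 * ‖FF w‖ := by
        refine (norm_sub_le _ _).trans ?_
        simp
    _ ≤ (-w.re + π) * (Real.exp w.re / Real.sin η) + 2 * (Real.exp w.re / Real.sin η) := by
        gcongr
        linarith [Real.pi_pos]
    _ = ((-w.re) * Real.exp w.re + (π + 2) * Real.exp w.re) / Real.sin η := by ring
    _ ≤ (3 + π) / Real.sin η := by
        apply div_le_div_of_nonneg_right _ hs.le
        nlinarith [Real.pi_pos]

theorem GG_refl (η : ℝ) (h0 : 0 < η) (h1 : η < π) (w : ℂ) (hw : w ∈ SS η) :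
    GG w = - GG (-w) - 4 * FF 0 := by
  have e1 := FF_refl η h0 h1 w hw
  have e2 := log_refl η h0 h1 w hw
  simp only [GG]
  rw [e2]
  linear_combination -2 * e1

theorem GG_bound (η : ℝ) (h0 : 0 < η) (h1 : η < π) (w : ℂ) (hw : w ∈ SS η) :
    ‖GG w‖ ≤ (3 + π) / Real.sin η + 4 * ‖FF 0‖ := by
  rcases le_total w.re 0 with h | h
  · have := GG_left η h0 h1 w hw h
    have := norm_nonneg (FF 0)
    linarith
  · rw [GG_refl η h0 h1 w hw]
    have := GG_left η h0 h1 (-w) (by simpa [SS] using hw) (by simpa using h)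
    refine (norm_sub_le _ _).trans ?_
    simpa using this

theorem main_aux (η : ℝ) (h0 : 0 < η) (h1 : η < π) (K : ℝ) (hK : ∀ w ∈ SS η, ‖GG w‖ ≤ K)
    (s : ℝ) (hs : 0 < s) (hs1 : s ≤ 1) (y : ℂ) (hy : (1 + s) * |y.im| ≤ π - η) :
    ‖FF (y * (1 + s)) - (1 + s) ^ 2 * FF y‖ ≤ 4 * K * s := by
  have mem : ∀ t ∈ Set.Icc 1 (1 + s), (t : ℂ) * y ∈ SS η := by
    intro t ht
    have : 0 < t := by linarith [ht.1]
    simp only [SS, Set.mem_ofPred_eq, Complex.mul_im, Complex.ofReal_re, Complex.ofReal_im,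
      zero_mul, add_zero, abs_mul, abs_of_pos this]
    exact le_trans (by gcongr; exact ht.2) hy
  have K0 : 0 ≤ K := (norm_nonneg _).trans (hK _ (mem 1 ⟨le_rfl, by linarith⟩))
  have := (convex_Icc (1:ℝ) (1+s)).norm_image_sub_le_of_norm_hasDerivWithin_le
    (f := fun t : ℝ => FF (t * y) / (t:ℂ) ^ 2)
    (f' := fun t : ℝ => GG (t * y) / (t:ℂ) ^ 3)
    (C := K) (x := 1) (y := 1 + s)
    (fun t ht => by
      have t0 : 0 < t := by linarith [ht.1]
      have t0' : (t:ℂ) ≠ 0 := by exact_mod_cast t0.ne'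
      have d1 : HasDerivAt (fun z : ℂ => z * y) y (t:ℂ) := by
        simpa using (hasDerivAt_id (t:ℂ)).mul_const y
      have d2 := (FF_deriv η h0 h1 _ (mem t ht)).comp (t:ℂ) d1
      have d3 := (d2.div ((hasDerivAt_id (t:ℂ)).pow 2) (by simpa using t0')).comp_ofReal
      refine (d3.congr_deriv ?_).hasDerivWithinAt
      simp [GG]
      field_simp)
    (fun t ht => by
      have t0 : 1 ≤ t := ht.1
      rw [norm_div, norm_pow, Complex.norm_real, Real.norm_of_nonneg (by linarith)]
      exact (div_le_self (norm_nonneg _) (one_le_pow₀ t0)).trans (hK _ (mem t ht)))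
    ⟨le_rfl, by linarith⟩ ⟨by linarith, le_rfl⟩
  simp only [Complex.ofReal_one, one_mul, one_pow, div_one, add_sub_cancel_left,
    Real.norm_of_nonneg hs.le] at this
  have n0 : (1 + s : ℂ) ≠ 0 := by
    have : (1 + s) ≠ 0 := by linarith
    exact_mod_cast this
  push_cast at this
  have e : FF (y * (1 + s)) - (1 + s) ^ 2 * FF y
      = (1 + s) ^ 2 * (FF ((1 + s) * y) / (1 + s) ^ 2 - FF y) := by
    rw [mul_comm y]; field_simp
  rw [e, norm_mul, norm_pow]
  have e2 : ‖(1 + s : ℂ)‖ = 1 + s := by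
    have : (1 + s : ℂ) = ((1 + s : ℝ) : ℂ) := by push_cast; rfl
    rw [this, Complex.norm_real, Real.norm_of_nonneg (by linarith)]
  rw [e2]
  calc (1 + s) ^ 2 * _ ≤ 2 ^ 2 * (K * s) := by
        gcongr; linarith
    _ = 4 * K * s := by ring

/-- for every `δ ∈ (0, π/2)` there is a constant `C_δ > 0` such
that for all `b ∈ (0, √(δ/(2(π-δ))))` and all `y` with
`Im y ∈ [-(π-δ),-δ] ∪ [δ, π-δ]`,
`|Re((-i/(2πb²)) Li₂(-e^{y(1+b²)}) - (-i/(2πb²))(1+b²)² Li₂(-e^{y}))| ≤ C_δ`. -/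
theorem dilog_rescaling_bound (δ : ℝ) (hδ : δ ∈ Set.Ioo 0 (π/2)) :
    ∃ C : ℝ, 0 < C ∧ ∀ b : ℝ, b ∈ Set.Ioo 0 (Real.sqrt (δ / (2 * (π - δ)))) →
      ∀ y : ℂ, y.im ∈ Set.Icc (-(π - δ)) (-δ) ∪ Set.Icc δ (π - δ) →
        |((-Complex.I / (2 * (π : ℂ) * (b : ℂ) ^ 2)) *
            Li2 (-Complex.exp (y * (1 + (b : ℂ) ^ 2))) -
          (-Complex.I / (2 * (π : ℂ) * (b : ℂ) ^ 2)) * (1 + (b : ℂ) ^ 2) ^ 2 *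
            Li2 (-Complex.exp y)).re| ≤ C := by
  obtain ⟨hd0, hd1⟩ := hδ
  have hpi := Real.pi_pos
  set K : ℝ := (3 + π) / Real.sin (δ/2) + 4 * ‖FF 0‖ with hKdef
  have hsin : 0 < Real.sin (δ/2) := Real.sin_pos_of_pos_of_lt_pi (by linarith) (by linarith)
  have hK0 : 0 < K := by positivity
  have hK := GG_bound (δ/2) (by linarith) (by linarith)
  refine ⟨4 * K / (2 * π), by positivity, fun b hb y hy => ?_⟩
  obtain ⟨hb0, hb1⟩ := hb
  have hs : b ^ 2 < δ / (2 * (π - δ)) := by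
    rwa [Real.lt_sqrt hb0.le] at hb1
  rw [lt_div_iff₀ (by linarith)] at hs
  have hb2 : 0 < b ^ 2 := by positivity
  have hs1 : b ^ 2 ≤ 1 := by
    by_contra h
    push Not at h
    nlinarith
  have him : |y.im| ≤ π - δ := by
    rw [abs_le]
    rcases hy with h | h <;> obtain ⟨h1, h2⟩ := h <;> constructor <;> linarith
  have := main_aux (δ/2) (by linarith) (by linarith) K hK (b^2) hb2 hs1 y (by
    have : (1 + b ^ 2) * |y.im| ≤ (1 + b ^ 2) * (π - δ) := by gcongr
    nlinarith)
  push_cast at this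
  refine (Complex.abs_re_le_norm _).trans ?_
  have e : (-Complex.I / (2 * (π : ℂ) * (b : ℂ) ^ 2)) *
            Li2 (-Complex.exp (y * (1 + (b : ℂ) ^ 2))) -
          (-Complex.I / (2 * (π : ℂ) * (b : ℂ) ^ 2)) * (1 + (b : ℂ) ^ 2) ^ 2 *
            Li2 (-Complex.exp y)
      = (-Complex.I / (2 * (π : ℂ) * (b : ℂ) ^ 2)) *
        (FF (y * (1 + (b:ℂ) ^ 2)) - (1 + (b:ℂ) ^ 2) ^ 2 * FF y) := by
    simp only [FF]; ring
  rw [e, norm_mul]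
  have e2 : ‖-Complex.I / (2 * (π : ℂ) * (b : ℂ) ^ 2)‖ = 1 / (2 * π * b ^ 2) := by
    simp [abs_of_pos hpi]
  rw [e2]
  calc _ ≤ 1 / (2 * π * b ^ 2) * (4 * K * b ^ 2) := by gcongr
    _ = 4 * K / (2 * π) := by field_simp
end
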